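/- Let U be a dense subring of ℝ and let A be a positive n×n matrix with entries in U. Then: (1) for every path-connected set C of positive n×n matrices all conjugate over ℝ to A with A ∈ C, the matrices in C which are conjugate over U to A fall into at most 2^{γ(A)−1} strong-shift-equivalence-over-U₊ classes, where γ(A) is the number of pairs (λ, j) with λ ∈ ℝ, 1 ≤ j ≤ n, such that rank((A−λI)^{j−1}) + rank((A−λI)^{j+1}) > 2·rank((A−λI)^{j}); (2) consequently, the set of positive n×n matrices conjugate over U to A intersects only finitely many strong-shift-equivalence-over-U₊ classes. -/

import Mathlib

open Matrix

/-- All entries of a real matrix lie in the set `S`. -/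
def entriesIn {m n : ℕ} (S : Set ℝ) (A : Matrix (Fin m) (Fin n) ℝ) : Prop :=
  ∀ i j, A i j ∈ S

/-- A matrix is positive if every entry is positive. -/
def PosEntries {m n : ℕ} (A : Matrix (Fin m) (Fin n) ℝ) : Prop :=
  ∀ i j, 0 < A i j

/-- Elementary strong shift equivalence over `S` between square real matrices
(of possibly different sizes). -/
def ESSE (S : Set ℝ) (p q : (n : ℕ) × Matrix (Fin n) (Fin n) ℝ) : Prop :=
  ∃ (R : Matrix (Fin p.1) (Fin q.1) ℝ) (S' : Matrix (Fin q.1) (Fin p.1) ℝ),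
    entriesIn S R ∧ entriesIn S S' ∧ p.2 = R * S' ∧ q.2 = S' * R

/-- Strong shift equivalence over `S`: a finite chain of elementary strong shift
equivalences. -/
def SSE (S : Set ℝ) : ((n : ℕ) × Matrix (Fin n) (Fin n) ℝ) →
    ((n : ℕ) × Matrix (Fin n) (Fin n) ℝ) → Prop :=
  Relation.ReflTransGen (ESSE S)

/-- Conjugacy over a subset `S` of `ℝ`. -/
def ConjOver {n : ℕ} (S : Set ℝ) (A B : Matrix (Fin n) (Fin n) ℝ) : Prop :=
  ∃ W Winv : Matrix (Fin n) (Fin n) ℝ, entriesIn S W ∧ entriesIn S Winv ∧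
    W * Winv = 1 ∧ Winv * W = 1 ∧ Winv * A * W = B

/-- `γ(A)`: the number of pairs `(λ, j)`, `λ ∈ ℝ`, `1 ≤ j ≤ n`, such that the real
Jordan form of `A` contains a `j × j` Jordan block with eigenvalue `λ`, detected by
the rank condition. -/
noncomputable def gammaOf {n : ℕ} (A : Matrix (Fin n) (Fin n) ℝ) : ℕ :=
  Set.ncard {p : ℝ × ℕ | 1 ≤ p.2 ∧ p.2 ≤ n ∧
    2 * ((A - p.1 • 1) ^ p.2).rank <
      ((A - p.1 • 1) ^ (p.2 - 1)).rank + ((A - p.1 • 1) ^ (p.2 + 1)).rank}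

section NondegenerateZeros

open MvPolynomial

variable {σ : Type*} [Fintype σ]

theorem MvPolynomial.hasFDerivAt_eval (p : MvPolynomial σ ℝ) (x : σ → ℝ) :
    HasFDerivAt (fun y => eval y p)
      (∑ j, eval x (pderiv j p) • ContinuousLinearMap.proj (R := ℝ) (φ := fun _ : σ => ℝ) j) x := by
  classical
  induction p using MvPolynomial.induction_on with
  | C a =>
    simp only [eval_C, pderiv_C, map_zero, zero_smul, Finset.sum_const_zero]
    exact hasFDerivAt_const a x
  | add p q hp hq =>
    have h : (fun y => eval y (p + q)) = fun y => eval y p + eval y q := by ext y; simp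
    rw [h]
    exact (hp.fun_add hq).congr_fderiv (by simp [add_smul, Finset.sum_add_distrib])
  | mul_X p i hp =>
    have h : (fun y => eval y (p * X i)) = fun y => eval y p *
        ContinuousLinearMap.proj (R := ℝ) (φ := fun _ : σ => ℝ) i y := by ext y; simp
    rw [h]
    refine (hp.fun_mul (ContinuousLinearMap.hasFDerivAt _)).congr_fderiv ?_
    ext v
    simp [pderiv_X, Pi.single_apply, Finset.mul_sum, apply_ite (eval x), mul_add,
      Finset.sum_add_distrib, mul_comm]
    exact Finset.sum_congr rfl fun _ _ => by ring

theorem MvPolynomial.exists_sum_mul_X_sub_C (p : MvPolynomial σ ℝ) (x : σ → ℝ) (hp : eval x p = 0) :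
    ∃ m : σ → MvPolynomial σ ℝ, p = ∑ j, m j * (X j - C (x j)) ∧
      ∀ j, eval x (m j) = eval x (pderiv j p) := by
  classical
  have key : ∀ p : MvPolynomial σ ℝ, ∃ m : σ → MvPolynomial σ ℝ,
      p - C (eval x p) = ∑ j, m j * (X j - C (x j)) := by
    intro p
    induction p using MvPolynomial.induction_on with
    | C a => exact ⟨0, by simp⟩
    | add p q hp hq =>
      obtain ⟨m, hm⟩ := hp
      obtain ⟨k, hk⟩ := hq
      refine ⟨m + k, ?_⟩
      simp only [Pi.add_apply, add_mul, Finset.sum_add_distrib, ← hm, ← hk, map_add]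
      ring
    | mul_X p i hp =>
      obtain ⟨m, hm⟩ := hp
      refine ⟨fun j => m j * X i + if j = i then C (eval x p) else 0, ?_⟩
      have : ∑ j, m j * X i * (X j - C (x j)) = X i * ∑ j, m j * (X j - C (x j)) := by
        rw [Finset.mul_sum]; exact Finset.sum_congr rfl fun _ _ => by ring
      simp only [add_mul, Finset.sum_add_distrib, this, ← hm, ite_mul, zero_mul,
        Finset.sum_ite_eq', Finset.mem_univ, if_true, map_mul, eval_X]
      ring
  obtain ⟨m, hm⟩ := key p
  rw [hp, map_zero, sub_zero] at hm
  refine ⟨m, hm, fun j => ?_⟩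
  have := congrArg (fun q => eval x (pderiv j q)) hm
  rw [this]
  simp [pderiv_X, Pi.single_apply, apply_ite (eval x)]

/-- A nondegenerate zero of a square polynomial system is an isolated point of its zero scheme:
the corresponding maximal ideal is a minimal prime. -/
theorem MvPolynomial.ker_eval_mem_minimalPrimes [DecidableEq σ] (f : σ → MvPolynomial σ ℝ)
    (x : σ → ℝ) (hf : ∀ i, eval x (f i) = 0)
    (hJ : (Matrix.of fun i j => eval x (pderiv j (f i))).det ≠ 0) :
    RingHom.ker (eval x) ∈ (Ideal.span (Set.range f)).minimalPrimes := by
  have hprime : (RingHom.ker (eval x)).IsPrime := RingHom.ker_isPrime _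
  refine ⟨⟨hprime, ?_⟩, ?_⟩
  · rw [Ideal.span_le]
    rintro _ ⟨i, rfl⟩
    exact hf i
  · rintro P ⟨hP, hfP⟩ hPm p hp
    choose m hm hmj using fun i => exists_sum_mul_X_sub_C (f i) x (hf i)
    let M : Matrix σ σ (MvPolynomial σ ℝ) := Matrix.of m
    have hMv : M.mulVec (fun j => X j - C (x j)) = f := by
      ext1 i
      rw [hm i]; rfl
    have hdet : M.det ∉ P := by
      intro h
      have h0 : eval x M.det = 0 := hPm h
      rw [RingHom.map_det] at h0
      apply hJ
      rw [← h0]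
      congr 1
      ext i j
      simp [M, hmj]
    have hX : ∀ j, X j - C (x j) ∈ P := by
      intro j
      have h1 : M.det * (X j - C (x j)) ∈ P := by
        have : M.adjugate.mulVec f = M.det • (fun j => X j - C (x j)) := by
          rw [← hMv, Matrix.mulVec_mulVec, Matrix.adjugate_mul, Matrix.smul_mulVec,
            Matrix.one_mulVec]
        have h2 := congrFun this j
        simp only [Pi.smul_apply, smul_eq_mul] at h2
        rw [← h2]
        exact P.sum_mem fun i _ => P.mul_mem_left _ (hfP (Ideal.subset_span ⟨i, rfl⟩))
      exact (hP.mem_or_mem h1).resolve_left hdet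
    obtain ⟨m', hm', -⟩ := exists_sum_mul_X_sub_C p x hp
    rw [hm']
    exact P.sum_mem fun j _ => P.mul_mem_left _ (hX j)

theorem MvPolynomial.finite_nondegenerate_zeros [DecidableEq σ] (f : σ → MvPolynomial σ ℝ) :
    {x : σ → ℝ | (∀ i, eval x (f i) = 0) ∧
      (Matrix.of fun i j => eval x (pderiv j (f i))).det ≠ 0}.Finite := by
  refine Set.Finite.of_finite_image (f := fun x => RingHom.ker (eval x))
    ((Ideal.finite_minimalPrimes_of_isNoetherianRing _ (Ideal.span (Set.range f))).subset ?_) ?_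
  · rintro _ ⟨x, hx, rfl⟩
    exact ker_eval_mem_minimalPrimes f x hx.1 hx.2
  · intro x _ y _ hxy
    ext j
    have : X j - C (x j) ∈ RingHom.ker (eval y) := by
      rw [← show RingHom.ker (eval x) = RingHom.ker (eval y) from hxy]
      simp [RingHom.mem_ker]
    simp [RingHom.mem_ker] at this
    linarith

theorem MvPolynomial.exists_finite_inter_nonempty (Q : MvPolynomial σ ℝ) :
    ∃ Z : Set (σ → ℝ), Z.Finite ∧ ∀ V : Set (σ → ℝ), V.Nonempty → IsOpen V →
      Bornology.IsBounded V → (∀ x ∈ V, eval x Q ≠ 0) →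
      (∀ x ∈ closure V, eval x Q ≠ 0 → x ∈ V) → (V ∩ Z).Nonempty := by
  classical
  let F : (σ → ℝ) → (σ → ℝ) := fun x i => eval x (pderiv i Q) / eval x Q
  have hFd : ∀ x, eval x Q ≠ 0 → DifferentiableAt ℝ F x := by
    intro x hx
    rw [differentiableAt_pi]
    intro i
    have h1 := (hasFDerivAt_eval (pderiv i Q) x).differentiableAt
    have h2 := (hasFDerivAt_eval Q x).differentiableAt
    simp only [F, div_eq_mul_inv]
    exact h1.mul (h2.inv hx)
  let s : Set (σ → ℝ) := {x | eval x Q ≠ 0 ∧ (fderiv ℝ F x).det = 0}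
  have hs : MeasureTheory.volume (F '' s) = 0 :=
    MeasureTheory.addHaar_image_eq_zero_of_det_fderivWithin_eq_zero MeasureTheory.volume
      (f' := fderiv ℝ F) (fun x hx => (hFd x hx.1).hasFDerivAt.hasFDerivWithinAt)
      fun x hx => hx.2
  obtain ⟨a, ha⟩ : ∃ a, a ∉ F '' s := by
    by_contra! h
    have : F '' s = Set.univ := Set.eq_univ_of_forall h
    rw [this] at hs
    exact NeZero.ne _ (MeasureTheory.Measure.measure_univ_eq_zero.1 hs)
  let f : σ → MvPolynomial σ ℝ := fun i => pderiv i Q - C (a i) * Q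
  refine ⟨_, finite_nondegenerate_zeros f, ?_⟩
  rintro V ⟨x0, hx0⟩ hVo hVb hVQ hVc
  let g : (σ → ℝ) → ℝ := fun x => (eval x Q) ^ 2 * Real.exp (-(2 * ∑ i, a i * x i))
  have hgc : Continuous g := by
    have := MvPolynomial.continuous_eval Q
    fun_prop
  obtain ⟨z, hz, hzmax⟩ := hVb.isCompact_closure.exists_isMaxOn ⟨x0, subset_closure hx0⟩
    hgc.continuousOn
  have hQz : eval z Q ≠ 0 := by
    intro h
    have h1 : g x0 ≤ g z := hzmax (subset_closure hx0)
    have h2 : g z = 0 := by simp [g, h]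
    have h3 : 0 < g x0 := by
      have := hVQ x0 hx0
      positivity
    linarith
  have hzV := hVc z hz hQz
  have hloc : IsLocalMax g z :=
    Filter.eventually_of_mem (hVo.mem_nhds hzV) fun y hy => hzmax (subset_closure hy)
  have hlin : HasFDerivAt (fun x : σ → ℝ => -(2 * ∑ i, a i * x i))
      (-((2 : ℝ) • ∑ i, a i • ContinuousLinearMap.proj (R := ℝ) (φ := fun _ : σ => ℝ) i)) z := by
    refine HasFDerivAt.neg (HasFDerivAt.const_mul ?_ 2)
    exact HasFDerivAt.fun_sum fun i _ =>
      ((ContinuousLinearMap.proj (R := ℝ) (φ := fun _ : σ => ℝ) i).hasFDerivAt).const_mul (a i)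
  have hg' := ((hasFDerivAt_eval Q z).pow 2).mul hlin.exp
  have hzero := hloc.hasFDerivAt_eq_zero hg'
  have hcrit : ∀ i, eval z (f i) = 0 := by
    intro i
    have h1 := congrArg (fun L => L (Pi.single i 1)) hzero
    simp [Pi.single_apply] at h1
    have h2 := Real.exp_pos (-(2 * ∑ i, a i * z i))
    have h3 : Real.exp (-(2 * ∑ i, a i * z i)) * (2 * eval z Q) *
        (eval z (pderiv i Q) - a i * eval z Q) = 0 := by linear_combination h1
    have h4 := (mul_eq_zero.1 h3).resolve_left (by positivity)
    simpa [f] using h4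
  have hFz : F z = a := by
    ext i
    have := hcrit i
    simp only [f, map_sub, map_mul, eval_C] at this
    simp only [F]
    field_simp
    linarith
  refine ⟨z, hzV, hcrit, ?_⟩
  have hdet : (fderiv ℝ F z).det ≠ 0 := fun h => ha ⟨z, ⟨hQz, h⟩, hFz⟩
  intro h
  obtain ⟨v, hv0, hv⟩ := Matrix.exists_mulVec_eq_zero_iff.2 h
  apply hv0
  have hinj : Function.Injective (fderiv ℝ F z) := by
    have : IsUnit (LinearMap.det (fderiv ℝ F z : (σ → ℝ) →ₗ[ℝ] (σ → ℝ))) := isUnit_iff_ne_zero.2 hdet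
    exact ((Module.End.isUnit_iff _).1 ((LinearMap.isUnit_iff_isUnit_det _).2 this)).1
  apply hinj
  rw [map_zero]
  ext i
  have hFi : HasFDerivAt (fun x => F x i)
      ((ContinuousLinearMap.proj (R := ℝ) (φ := fun _ : σ => ℝ) i).comp (fderiv ℝ F z)) z :=
    hasFDerivAt_pi'.1 (hFd z hQz).hasFDerivAt i
  have h1 := (hasFDerivAt_eval Q z).mul (hFi.sub_const (a i))
  have h2 : (fun x => eval x Q * (F x i - a i)) =ᶠ[nhds z] fun x => eval x (f i) := by
    have : ∀ᶠ x in nhds z, eval x Q ≠ 0 :=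
      (MvPolynomial.continuous_eval Q).continuousAt.eventually_ne hQz
    filter_upwards [this] with x hx
    simp only [F, f, map_sub, map_mul, eval_C]
    field_simp
  have h3 := (hasFDerivAt_eval (f i) z).unique (h1.congr_of_eventuallyEq h2.symm)
  have h4 := congrArg (fun L => L v) h3
  have h5 := congrFun hv i
  simp only [Matrix.mulVec, dotProduct, Matrix.of_apply, Pi.zero_apply] at h5
  simp [hFz, h5] at h4
  exact h4.resolve_left hQz

end NondegenerateZeros

section Density

variable {n : ℕ}

theorem entriesIn_one (U : Subring ℝ) : entriesIn (U : Set ℝ) (1 : Matrix (Fin n) (Fin n) ℝ) := by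
  intro i j
  rw [Matrix.one_apply]
  split_ifs
  · exact U.one_mem
  · exact U.zero_mem

theorem entriesIn.mul {U : Subring ℝ} {k l m : ℕ} {A : Matrix (Fin k) (Fin l) ℝ}
    {B : Matrix (Fin l) (Fin m) ℝ} (hA : entriesIn (U : Set ℝ) A) (hB : entriesIn (U : Set ℝ) B) :
    entriesIn (U : Set ℝ) (A * B) := by
  intro i j
  rw [Matrix.mul_apply]
  exact U.sum_mem fun x _ => U.mul_mem (hA i x) (hB x j)

/-- The invertible matrices over `U` whose inverse is also over `U`, as real matrices. -/
def unitsOver (U : Subring ℝ) (n : ℕ) : Submonoid (Matrix (Fin n) (Fin n) ℝ) where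
  carrier := {H | entriesIn (U : Set ℝ) H ∧ entriesIn (U : Set ℝ) H⁻¹ ∧ IsUnit H.det}
  mul_mem' := by
    rintro A B ⟨h1, h2, h3⟩ ⟨k1, k2, k3⟩
    refine ⟨h1.mul k1, ?_, ?_⟩
    · rw [Matrix.mul_inv_rev]
      exact k2.mul h2
    · rw [Matrix.det_mul]
      exact h3.mul k3
  one_mem' := ⟨entriesIn_one U, by rw [inv_one]; exact entriesIn_one U, by simp⟩

theorem mem_unitsOver_of_mul_eq_one {U : Subring ℝ} {W V : Matrix (Fin n) (Fin n) ℝ}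
    (hW : entriesIn (U : Set ℝ) W) (hV : entriesIn (U : Set ℝ) V) (h : W * V = 1) :
    W ∈ unitsOver U n :=
  ⟨hW, by rw [Matrix.inv_eq_right_inv h]; exact hV, Matrix.isUnit_det_of_right_inverse h⟩

/-- Positive real multiples of elements of `unitsOver U n`. -/
def scaledUnitsOver (U : Subring ℝ) (n : ℕ) : Submonoid (Matrix (Fin n) (Fin n) ℝ) where
  carrier := {G | ∃ s : ℝ, 0 < s ∧ ∃ H ∈ unitsOver U n, G = s • H}
  mul_mem' := by
    rintro _ _ ⟨s, hs, H, hH, rfl⟩ ⟨t, ht, K, hK, rfl⟩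
    exact ⟨s * t, mul_pos hs ht, H * K, mul_mem hH hK, by simp [smul_smul, mul_comm]⟩
  one_mem' := ⟨1, one_pos, 1, one_mem _, by simp⟩

theorem transvection_mem_unitsOver {U : Subring ℝ} {i j : Fin n} (hij : i ≠ j) {c : ℝ}
    (hc : c ∈ U) : transvection i j c ∈ unitsOver U n := by
  have key : ∀ c ∈ U, entriesIn (U : Set ℝ) (transvection i j c) := by
    intro c hc a b
    rw [transvection, Matrix.add_apply, Matrix.single_apply]
    refine U.add_mem (entriesIn_one U a b) ?_
    split_ifs
    · exact hc
    · exact U.zero_mem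
  refine mem_unitsOver_of_mul_eq_one (key c hc) (key (-c) (U.neg_mem hc)) ?_
  rw [transvection_mul_transvection_same i j hij]
  simp

theorem transvection_mem_closure {U : Subring ℝ} (hU : Dense (U : Set ℝ)) {i j : Fin n}
    (hij : i ≠ j) (c : ℝ) : transvection i j c ∈ (scaledUnitsOver U n).topologicalClosure := by
  have hcont : Continuous fun c : ℝ => transvection i j c := by
    refine continuous_matrix fun a b => ?_
    simp only [transvection, Matrix.add_apply, Matrix.single_apply]
    split_ifs <;> fun_prop
  refine map_mem_closure hcont (hU c) fun x hx => ?_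
  exact ⟨1, one_pos, _, transvection_mem_unitsOver hij hx, by simp⟩

theorem transvections_mul_eq_diagonal {i j : Fin n} (hij : i ≠ j) {a : ℝ} (ha : a ≠ 0) :
    transvection i j a * transvection j i (-a⁻¹) * transvection i j a *
      (transvection i j (-1) * transvection j i 1 * transvection i j (-1)) =
    diagonal (Function.update (Function.update 1 i a) j a⁻¹) := by
  have h1 : ∀ b : ℝ, b ≠ 0 → transvection i j b * transvection j i (-b⁻¹) * transvection i j b =
      1 - single i i 1 - single j j 1 + single i j b - single j i b⁻¹ := by
    intro b hb
    simp [transvection, mul_add, add_mul, hij.symm, single_mul_single_of_ne, ← single_neg, hb]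
    abel
  have h2 := h1 (-1) (by norm_num)
  norm_num at h2
  rw [h1 a ha, h2]
  simp [mul_add, add_mul, hij, hij.symm, single_mul_single_of_ne, mul_sub, sub_mul]
  ext x y
  simp only [Matrix.sub_apply, Matrix.add_apply, Matrix.single_apply, Matrix.one_apply, diagonal_apply,
    Function.update_apply, Matrix.neg_apply, Pi.one_apply]
  clear h1 h2
  grind

theorem diagonal_pos_mem_closure {U : Subring ℝ} (hU : Dense (U : Set ℝ)) (v : Fin n → ℝ)
    (hv : ∀ i, 0 < v i) : diagonal v ∈ (scaledUnitsOver U n).topologicalClosure := by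
  rcases Nat.eq_zero_or_pos n with rfl | hn
  · rw [Subsingleton.elim (diagonal v) 1]
    exact one_mem _
  let i : Fin n := ⟨0, hn⟩
  let r : ℝ := (∏ j, v j) ^ ((n : ℝ)⁻¹)
  have hP : 0 < ∏ j, v j := Finset.prod_pos fun j _ => hv j
  have hr : 0 < r := Real.rpow_pos_of_pos hP _
  have hrn : r ^ n = ∏ j, v j := Real.rpow_inv_natCast_pow hP.le hn.ne'
  let S : Submonoid (Fin n → ℝ) :=
    (scaledUnitsOver U n).topologicalClosure.comap (diagonalRingHom (Fin n) ℝ).toMonoidHom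
  have hS : ∀ w, w ∈ S ↔ diagonal w ∈ (scaledUnitsOver U n).topologicalClosure := fun w => Iff.rfl
  have hconst : (fun _ => r) ∈ S := by
    rw [hS]
    refine (scaledUnitsOver U n).le_topologicalClosure ⟨r, hr, 1, one_mem _, ?_⟩
    ext a b
    simp [diagonal_apply, Matrix.one_apply]
  have hh : ∀ j ≠ i, ∀ a : ℝ, a ≠ 0 →
      Function.update (Function.update (1 : Fin n → ℝ) i a⁻¹) j a ∈ S := by
    intro j hj a ha
    have := transvections_mul_eq_diagonal (a := a⁻¹) hj.symm (inv_ne_zero ha)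
    rw [inv_inv] at this
    rw [hS, ← this]
    have ht := fun (c : ℝ) => transvection_mem_closure hU hj c
    have ht' := fun (c : ℝ) => transvection_mem_closure hU hj.symm c
    exact mul_mem (mul_mem (mul_mem (ht' _) (ht _)) (ht' _)) (mul_mem (mul_mem (ht' _) (ht _)) (ht' _))
  rw [← hS]
  have hprod : v = (fun _ => r) * ∏ j ∈ Finset.univ.erase i,
      Function.update (Function.update (1 : Fin n → ℝ) i (v j / r)⁻¹) j (v j / r) := by
    ext k
    rw [Pi.mul_apply, Finset.prod_apply]
    by_cases hk : k = i
    · subst hk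
      have h1 : ∏ j ∈ Finset.univ.erase i,
          Function.update (Function.update (1 : Fin n → ℝ) i (v j / r)⁻¹) j (v j / r) i =
          ∏ j ∈ Finset.univ.erase i, (r / v j) := by
        refine Finset.prod_congr rfl fun j hj => ?_
        rw [Function.update_of_ne (Finset.ne_of_mem_erase hj).symm, Function.update_self, inv_div]
      rw [h1, Finset.prod_div_distrib, Finset.prod_const, Finset.card_erase_of_mem (Finset.mem_univ _),
        Finset.card_univ, Fintype.card_fin]
      have h2 := Finset.mul_prod_erase Finset.univ v (Finset.mem_univ i)
      rw [← hrn] at h2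
      have h3 : r ^ n = r * r ^ (n - 1) := by rw [← pow_succ', Nat.sub_add_cancel hn]
      have h4 : 0 < ∏ j ∈ Finset.univ.erase i, v j := Finset.prod_pos fun j _ => hv j
      field_simp
      rw [← h3, ← h2]
    · rw [Finset.prod_eq_single k]
      · simp; field_simp
      · intro b _ hb
        rw [Function.update_of_ne hb.symm, Function.update_of_ne hk, Pi.one_apply]
      · intro h
        simp [hk] at h
  rw [hprod]
  exact mul_mem hconst (S.prod_mem fun j hj => hh j (Finset.ne_of_mem_erase hj) _
    (div_ne_zero (hv j).ne' hr.ne'))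

theorem mem_closure_scaledUnitsOver {U : Subring ℝ} (hU : Dense (U : Set ℝ))
    (G : Matrix (Fin n) (Fin n) ℝ) (hG : G.det ≠ 0) :
    G ∈ closure (scaledUnitsOver U n : Set (Matrix (Fin n) (Fin n) ℝ)) := by
  change G ∈ (scaledUnitsOver U n).topologicalClosure
  refine diagonal_transvection_induction_of_det_ne_zero _ G hG ?_
    (fun t => transvection_mem_closure hU t.hij t.c) fun A B _ _ hA hB => mul_mem hA hB
  intro D hD
  have hD' : ∀ i, D i ≠ 0 := by
    intro i hi
    apply hD
    rw [det_diagonal]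
    exact Finset.prod_eq_zero (Finset.mem_univ i) hi
  have hsign : diagonal (fun i => (SignType.sign (D i) : ℝ)) ∈ unitsOver U n := by
    have h1 : entriesIn (U : Set ℝ) (diagonal (fun i => (SignType.sign (D i) : ℝ))) := by
      intro a b
      rw [diagonal_apply]
      split_ifs
      · cases SignType.sign (D a)
        · exact U.zero_mem
        · exact U.neg_mem U.one_mem
        · exact U.one_mem
      · exact U.zero_mem
    refine mem_unitsOver_of_mul_eq_one h1 h1 ?_
    rw [diagonal_mul_diagonal, ← diagonal_one]
    congr 1
    ext i
    rcases lt_or_gt_of_ne (hD' i) with h | h <;> simp [h]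
  have : diagonal D = diagonal (fun i => (SignType.sign (D i) : ℝ)) * diagonal fun i => |D i| := by
    rw [diagonal_mul_diagonal]
    congr 1
    ext i
    exact (sign_mul_abs (D i)).symm
  rw [this]
  refine mul_mem ((scaledUnitsOver U n).le_topologicalClosure ⟨1, one_pos, _, hsign, by simp⟩)
    (diagonal_pos_mem_closure hU _ fun i => abs_pos.2 (hD' i))

end Density

section Classes

open Filter Topology

variable {n : ℕ}

theorem ESSE.symm {S : Set ℝ} {p q : (n : ℕ) × Matrix (Fin n) (Fin n) ℝ} (h : ESSE S p q) :
    ESSE S q p := by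
  obtain ⟨R, T, hR, hT, h1, h2⟩ := h
  exact ⟨T, R, hT, hR, h2, h1⟩

theorem SSE.symm {S : Set ℝ} {p q : (n : ℕ) × Matrix (Fin n) (Fin n) ℝ} (h : SSE S p q) :
    SSE S q p := by
  induction h with
  | refl => exact Relation.ReflTransGen.refl
  | tail _ hbc ih => exact Relation.ReflTransGen.head hbc.symm ih

theorem SSE.trans {S : Set ℝ} {p q r : (n : ℕ) × Matrix (Fin n) (Fin n) ℝ} (h : SSE S p q)
    (h' : SSE S q r) : SSE S p r :=
  Relation.ReflTransGen.trans h h'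

theorem Matrix.continuousAt_inv_of_isUnit_det {G : Matrix (Fin n) (Fin n) ℝ} (hG : IsUnit G.det) :
    ContinuousAt (fun X : Matrix (Fin n) (Fin n) ℝ => X⁻¹) G := by
  simp only [Matrix.inv_def, Ring.inverse_eq_inv']
  exact ContinuousAt.smul (continuous_id.matrix_det.continuousAt.inv₀ hG.ne_zero)
    continuous_id.matrix_adjugate.continuousAt

theorem Matrix.eventually_isUnit_det {G : Matrix (Fin n) (Fin n) ℝ} (hG : IsUnit G.det) :
    ∀ᶠ X in 𝓝 G, IsUnit X.det :=
  ((continuous_id.matrix_det.continuousAt (x := G)).eventually_ne hG.ne_zero).mono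
    fun _ h => isUnit_iff_ne_zero.2 h

theorem PosEntries.eventually {α : Type*} [TopologicalSpace α] {f : α → Matrix (Fin n) (Fin n) ℝ}
    {a : α} (hf : ContinuousAt f a) (h : PosEntries (f a)) : ∀ᶠ x in 𝓝 a, PosEntries (f x) := by
  simp only [PosEntries, eventually_all]
  intro i j
  have h1 : ContinuousAt (fun x => f x i j) a :=
    (continuous_id.matrix_elem i j).continuousAt.comp hf
  exact h1.eventually_const_lt (h i j)

theorem PosEntries.smul {s : ℝ} (hs : 0 < s) {M : Matrix (Fin n) (Fin n) ℝ} (h : PosEntries M) :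
    PosEntries (s • M) := fun i j => by
  simpa using mul_pos hs (h i j)

theorem Matrix.smul_inv_mul_smul {s : ℝ} (hs : s ≠ 0) (A H : Matrix (Fin n) (Fin n) ℝ)
    (hH : IsUnit H.det) : (s • H)⁻¹ * A * (s • H) = H⁻¹ * A * H := by
  have : (s • H)⁻¹ = s⁻¹ • H⁻¹ := by
    refine Matrix.inv_eq_left_inv ?_
    rw [smul_mul_smul_comm, inv_mul_cancel₀ hs, Matrix.nonsing_inv_mul _ hH, one_smul]
  rw [this]
  simp [smul_smul, hs]

/-- The invertible matrices conjugating `A` to a positive matrix. -/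
def conjDomain (A : Matrix (Fin n) (Fin n) ℝ) : Set (Matrix (Fin n) (Fin n) ℝ) :=
  {G | IsUnit G.det ∧ PosEntries (G⁻¹ * A * G)}

theorem isOpen_conjDomain (A : Matrix (Fin n) (Fin n) ℝ) : IsOpen (conjDomain A) := by
  rw [isOpen_iff_mem_nhds]
  rintro G ⟨hG, hpos⟩
  have hc : ContinuousAt (fun X => X⁻¹ * A * X) G :=
    ((Matrix.continuousAt_inv_of_isUnit_det hG).mul continuousAt_const).mul continuousAt_id
  filter_upwards [Matrix.eventually_isUnit_det hG, hpos.eventually hc] with X h1 h2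
  exact ⟨h1, h2⟩

theorem smul_mem_conjDomain {A G : Matrix (Fin n) (Fin n) ℝ} (hG : G ∈ conjDomain A) {s : ℝ}
    (hs : s ≠ 0) : s • G ∈ conjDomain A := by
  refine ⟨?_, ?_⟩
  · rw [Matrix.det_smul]
    exact (isUnit_iff_ne_zero.2 (pow_ne_zero _ hs)).mul hG.1
  · rw [Matrix.smul_inv_mul_smul hs A G hG.1]
    exact hG.2

theorem exists_smul_unitsOver {U : Subring ℝ} (hU : Dense (U : Set ℝ))
    {G : Matrix (Fin n) (Fin n) ℝ} (hG : IsUnit G.det) {p : Matrix (Fin n) (Fin n) ℝ → Prop}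
    (hp : ∀ᶠ X in 𝓝 G, p X) : ∃ s : ℝ, 0 < s ∧ ∃ H ∈ unitsOver U n, p (s • H) := by
  obtain ⟨_, ⟨s, hs, H, hH, rfl⟩, h⟩ :=
    ((mem_closure_iff_frequently.1 (mem_closure_scaledUnitsOver hU G hG.ne_zero)).and_eventually
      hp).exists
  exact ⟨s, hs, H, hH, h⟩

theorem exists_pos_unitsOver {U : Subring ℝ} (hU : Dense (U : Set ℝ))
    {B : Matrix (Fin n) (Fin n) ℝ} (hB : PosEntries B) :
    ∃ P ∈ unitsOver U n, PosEntries P ∧ PosEntries (B * P⁻¹) := by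
  let f : ℝ → Matrix (Fin n) (Fin n) ℝ := fun δ => 1 + δ • Matrix.of fun _ _ => 1
  have hf : Continuous f := by fun_prop
  have hf0 : f 0 = 1 := by simp [f]
  have hev : ∀ᶠ X in 𝓝 (1 : Matrix (Fin n) (Fin n) ℝ), IsUnit X.det ∧ PosEntries (B * X⁻¹) := by
    refine (Matrix.eventually_isUnit_det (by simp)).and (PosEntries.eventually ?_ (by simpa using hB))
    exact continuousAt_const.mul (Matrix.continuousAt_inv_of_isUnit_det (by simp))
  have hev' : ∀ᶠ δ in 𝓝[>] (0 : ℝ), IsUnit (f δ).det ∧ PosEntries (B * (f δ)⁻¹) :=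
    (hf.tendsto' 0 1 hf0 |>.mono_left nhdsWithin_le_nhds).eventually hev
  obtain ⟨δ, ⟨h1, h2⟩, hδ⟩ := (hev'.and self_mem_nhdsWithin).exists
  have h3 : PosEntries (f δ) := by
    intro i j
    have : (0 : ℝ) ≤ (1 : Matrix (Fin n) (Fin n) ℝ) i j := by
      rw [Matrix.one_apply]; split_ifs <;> norm_num
    simp only [f, Matrix.add_apply, Matrix.smul_apply, Matrix.of_apply, smul_eq_mul, mul_one]
    exact add_pos_of_nonneg_of_pos this hδ
  obtain ⟨s, hs, P, hP, h4, h5, h6⟩ := exists_smul_unitsOver hU h1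
    ((Matrix.eventually_isUnit_det h1).and ((PosEntries.eventually continuousAt_id h3).and
      (PosEntries.eventually
        (continuousAt_const.mul (Matrix.continuousAt_inv_of_isUnit_det h1)) h2)))
  refine ⟨P, hP, ?_, ?_⟩
  · have := PosEntries.smul (inv_pos.2 hs) h5
    simpa [smul_smul, hs.ne'] using this
  · have h6' : PosEntries (B * (s • P)⁻¹) := h6
    have := PosEntries.smul hs h6'
    have h7 : (s • P)⁻¹ = s⁻¹ • P⁻¹ := by
      refine Matrix.inv_eq_left_inv ?_
      rw [smul_mul_smul_comm, inv_mul_cancel₀ hs.ne', Matrix.nonsing_inv_mul _ hP.2.2, one_smul]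
    rw [h7] at this
    simpa [smul_smul, hs.ne'] using this

theorem eventually_sse {U : Subring ℝ} (hU : Dense (U : Set ℝ)) {A : Matrix (Fin n) (Fin n) ℝ}
    (hA : entriesIn (U : Set ℝ) A) {G : Matrix (Fin n) (Fin n) ℝ} (hG : G ∈ conjDomain A) :
    ∀ᶠ p in 𝓝 (G, G), ∀ H ∈ unitsOver U n, ∀ K ∈ unitsOver U n, ∀ s t : ℝ, 0 < s → 0 < t →
      p.1 = s • H → p.2 = t • K →
      SSE {x : ℝ | x ∈ U ∧ 0 ≤ x} ⟨n, H⁻¹ * A * H⟩ ⟨n, K⁻¹ * A * K⟩ := by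
  obtain ⟨P, hP, hP1, hP2⟩ := exists_pos_unitsOver hU hG.2
  have hinv1 : ContinuousAt (fun p : Matrix (Fin n) (Fin n) ℝ × Matrix (Fin n) (Fin n) ℝ => p.1⁻¹)
      (G, G) :=
    ContinuousAt.comp (f := Prod.fst) (Matrix.continuousAt_inv_of_isUnit_det hG.1) continuousAt_fst
  have hinv2 : ContinuousAt (fun p : Matrix (Fin n) (Fin n) ℝ × Matrix (Fin n) (Fin n) ℝ => p.2⁻¹)
      (G, G) :=
    ContinuousAt.comp (f := Prod.snd) (Matrix.continuousAt_inv_of_isUnit_det hG.1) continuousAt_snd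
  have e1 : ∀ᶠ p in 𝓝 (G, G), PosEntries (p.1⁻¹ * A * p.1 * P⁻¹) := by
    refine PosEntries.eventually ?_ hP2
    exact ((hinv1.mul continuousAt_const).mul continuousAt_fst).mul continuousAt_const
  have e2 : ∀ᶠ p in 𝓝 (G, G), PosEntries (P * (p.1⁻¹ * p.2)) := by
    refine PosEntries.eventually ?_ ?_
    · exact continuousAt_const.mul (hinv1.mul continuousAt_snd)
    · simpa [Matrix.nonsing_inv_mul _ hG.1] using hP1
  have e3 : ∀ᶠ p in 𝓝 (G, G), PosEntries (p.2⁻¹ * A * p.1 * P⁻¹) := by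
    refine PosEntries.eventually ?_ hP2
    exact ((hinv2.mul continuousAt_const).mul continuousAt_fst).mul continuousAt_const
  filter_upwards [e1, e2, e3] with p h1 h2 h3 H hH K hK s t hs ht hpH hpK
  have invsmul : ∀ {s : ℝ} (_ : 0 < s) {H : Matrix (Fin n) (Fin n) ℝ} (_ : IsUnit H.det),
      (s • H)⁻¹ = s⁻¹ • H⁻¹ := by
    intro s hs H hH
    refine Matrix.inv_eq_left_inv ?_
    rw [smul_mul_smul_comm, inv_mul_cancel₀ hs.ne', Matrix.nonsing_inv_mul _ hH, one_smul]
  have hHH := Matrix.mul_nonsing_inv _ hH.2.2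
  have hKK := Matrix.mul_nonsing_inv _ hK.2.2
  have hPP := Matrix.nonsing_inv_mul _ hP.2.2
  rw [hpH, Matrix.smul_inv_mul_smul hs.ne' A H hH.2.2] at h1
  rw [hpH, hpK, invsmul hs hH.2.2] at h2
  rw [hpH, hpK, invsmul ht hK.2.2] at h3
  have h2' : PosEntries (P * (H⁻¹ * K)) := by
    have := PosEntries.smul (mul_pos hs (inv_pos.2 ht)) h2
    convert this using 1
    simp only [Matrix.mul_smul, Matrix.smul_mul, smul_smul]
    field_simp
    simp
  have h3' : PosEntries (K⁻¹ * A * H * P⁻¹) := by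
    have := PosEntries.smul (mul_pos (inv_pos.2 hs) ht) h3
    convert this using 1
    simp only [Matrix.mul_smul, Matrix.smul_mul, smul_smul]
    field_simp
    simp
  have mem : ∀ {M : Matrix (Fin n) (Fin n) ℝ}, entriesIn (U : Set ℝ) M → PosEntries M →
      entriesIn {x : ℝ | x ∈ U ∧ 0 ≤ x} M := fun hM hM' i j => ⟨hM i j, (hM' i j).le⟩
  have uH := hH.1
  have uK := hK.1
  have uP := hP.1
  have uHi := hH.2.1
  have uKi := hK.2.1
  have uPi := hP.2.1
  refine SSE.trans (q := ⟨n, P * (H⁻¹ * A * H * P⁻¹)⟩) ?_ ?_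
  · refine Relation.ReflTransGen.single ⟨H⁻¹ * A * H * P⁻¹, P, mem ?_ h1, mem uP hP1, ?_, rfl⟩
    · exact ((uHi.mul hA).mul uH).mul uPi
    · simp only [Matrix.mul_assoc, hPP, Matrix.mul_one]
  · refine Relation.ReflTransGen.single ⟨P * (H⁻¹ * K), K⁻¹ * A * H * P⁻¹,
      mem (uP.mul (uHi.mul uK)) h2', mem (((uKi.mul hA).mul uH).mul uPi) h3', ?_, ?_⟩
    · calc P * (H⁻¹ * A * H * P⁻¹) = P * (H⁻¹ * (1 * (A * (H * P⁻¹)))) := by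
            simp only [Matrix.mul_assoc, Matrix.one_mul]
        _ = _ := by rw [← hKK]; simp only [Matrix.mul_assoc]
    · calc K⁻¹ * A * K = K⁻¹ * A * (H * ((P⁻¹ * P) * (H⁻¹ * K))) := by
            rw [hPP, Matrix.one_mul, ← Matrix.mul_assoc H, hHH, Matrix.one_mul]
        _ = _ := by simp only [Matrix.mul_assoc]

/-- `B` represents the strong shift equivalence class over `U₊` of the matrices `H⁻¹ * A * H`,
for the `H` invertible over `U` which have a positive multiple close to `G`. -/
def RepresentsAt (U : Subring ℝ) (A G B : Matrix (Fin n) (Fin n) ℝ) : Prop :=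
  ∀ᶠ X in 𝓝 G, ∀ H ∈ unitsOver U n, ∀ s : ℝ, 0 < s → X = s • H →
    SSE {x : ℝ | x ∈ U ∧ 0 ≤ x} ⟨n, H⁻¹ * A * H⟩ ⟨n, B⟩

variable {U : Subring ℝ} {A G B B' : Matrix (Fin n) (Fin n) ℝ}

theorem RepresentsAt.eventually (h : RepresentsAt U A G B) : ∀ᶠ X in 𝓝 G, RepresentsAt U A X B :=
  eventually_eventually_nhds.2 h

theorem exists_representsAt (hU : Dense (U : Set ℝ)) (hA : entriesIn (U : Set ℝ) A)
    (hG : G ∈ conjDomain A) : ∃ B, RepresentsAt U A G B := by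
  have h := eventually_sse hU hA hG
  rw [nhds_prod_eq] at h
  obtain ⟨s, hs, H, hH, h'⟩ := exists_smul_unitsOver hU hG.1 h.curry
  refine ⟨H⁻¹ * A * H, ?_⟩
  filter_upwards [h'] with X hX K hK t ht hXt
  exact (hX H hH K hK s t hs ht rfl hXt).symm

theorem RepresentsAt.sse (hU : Dense (U : Set ℝ)) (hG : IsUnit G.det)
    (h : RepresentsAt U A G B) (h' : RepresentsAt U A G B') :
    SSE {x : ℝ | x ∈ U ∧ 0 ≤ x} ⟨n, B⟩ ⟨n, B'⟩ := by
  obtain ⟨s, hs, H, hH, h1, h2⟩ := exists_smul_unitsOver hU hG (Filter.Eventually.and h h')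
  exact (h1 H hH s hs rfl).symm.trans (h2 H hH s hs rfl)

theorem RepresentsAt.congr (h : RepresentsAt U A G B)
    (hB : SSE {x : ℝ | x ∈ U ∧ 0 ≤ x} ⟨n, B⟩ ⟨n, B'⟩) : RepresentsAt U A G B' :=
  Filter.Eventually.mono h fun _ hX H hH s hs hXs => (hX H hH s hs hXs).trans hB

theorem representsAt_of_frequently (hU : Dense (U : Set ℝ)) (hA : entriesIn (U : Set ℝ) A)
    (hG : G ∈ conjDomain A) (h : ∃ᶠ X in 𝓝 G, RepresentsAt U A X B) : RepresentsAt U A G B := by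
  obtain ⟨B', hB'⟩ := exists_representsAt hU hA hG
  obtain ⟨X, hX, hX', hXG⟩ := (h.and_eventually (hB'.eventually.and
    (Matrix.eventually_isUnit_det hG.1))).exists
  exact hB'.congr (hX'.sse hU hXG hX)

theorem representsAt_self (hU : Dense (U : Set ℝ)) (hA : entriesIn (U : Set ℝ) A)
    (hG : G ∈ conjDomain A) (hGU : G ∈ unitsOver U n) : RepresentsAt U A G (G⁻¹ * A * G) := by
  obtain ⟨B, hB⟩ := exists_representsAt hU hA hG
  exact hB.congr (hB.self_of_nhds G hGU 1 one_pos (by simp)).symm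

theorem RepresentsAt.neg (h : RepresentsAt U A G B) : RepresentsAt U A (-G) B := by
  have h1 : Tendsto (fun X : Matrix (Fin n) (Fin n) ℝ => -X) (𝓝 (-G)) (𝓝 G) :=
    continuous_neg.tendsto' _ _ (neg_neg G)
  filter_upwards [h1.eventually h] with X hX H hH s hs hXs
  have hinv : (-H)⁻¹ = -H⁻¹ := Matrix.inv_eq_left_inv (by
    rw [neg_mul_neg, Matrix.nonsing_inv_mul _ hH.2.2])
  have hH' : -H ∈ unitsOver U n := by
    refine mem_unitsOver_of_mul_eq_one (V := -H⁻¹) (fun i j => U.neg_mem (hH.1 i j))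
      (fun i j => U.neg_mem (hH.2.1 i j)) ?_
    rw [neg_mul_neg, Matrix.mul_nonsing_inv _ hH.2.2]
  have := hX (-H) hH' s hs (by simp [hXs])
  rw [hinv] at this
  simpa using this

theorem RepresentsAt.smul {c : ℝ} (hc : 0 < c) (h : RepresentsAt U A G B) :
    RepresentsAt U A (c • G) B := by
  have h1 : Tendsto (fun X : Matrix (Fin n) (Fin n) ℝ => c⁻¹ • X) (𝓝 (c • G)) (𝓝 G) :=
    (continuous_const_smul _).tendsto' _ _ (by simp [smul_smul, hc.ne'])
  filter_upwards [h1.eventually h] with X hX H hH s hs hXs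
  exact hX H hH (c⁻¹ * s) (by positivity) (by simp [hXs, smul_smul])

theorem RepresentsAt.of_joinedIn (hU : Dense (U : Set ℝ)) (hA : entriesIn (U : Set ℝ) A)
    {G' : Matrix (Fin n) (Fin n) ℝ} (hGG' : JoinedIn (conjDomain A) G G')
    (h : RepresentsAt U A G B) : RepresentsAt U A G' B := by
  obtain ⟨γ, hγ⟩ := hGG'
  have hclopen : IsClopen {t | RepresentsAt U A (γ t) B} := by
    refine ⟨isClosed_iff_frequently.2 fun t ht => ?_, isOpen_iff_mem_nhds.2 fun t ht => ?_⟩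
    · exact representsAt_of_frequently hU hA (hγ t) (γ.continuous.continuousAt.tendsto.frequently ht)
    · exact γ.continuous.continuousAt.tendsto.eventually (RepresentsAt.eventually ht)
  have huniv := hclopen.eq_univ ⟨0, by simpa using h⟩
  have : (1 : unitInterval) ∈ {t | RepresentsAt U A (γ t) B} := huniv ▸ Set.mem_univ _
  simpa using this

end Classes

section Lifting

open Filter Topology Module

theorem LinearMap.eventually_exists_ker_mem {α V W : Type*} [TopologicalSpace α]
    [AddCommGroup V] [Module ℝ V] [FiniteDimensional ℝ V] [TopologicalSpace V]
    [IsTopologicalAddGroup V] [ContinuousSMul ℝ V] [T2Space V]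
    [AddCommGroup W] [Module ℝ W] [FiniteDimensional ℝ W] [TopologicalSpace W]
    [IsTopologicalAddGroup W] [ContinuousSMul ℝ W] [T2Space W]
    {T : α → V →ₗ[ℝ] W} (hT : ∀ v, Continuous fun a => T a v) {a₀ : α} {v₀ : V}
    (hv₀ : T a₀ v₀ = 0) {N : Set V} (hN : N ∈ 𝓝 v₀) :
    ∀ᶠ a in 𝓝 a₀, finrank ℝ (LinearMap.ker (T a₀)) ≤ finrank ℝ (LinearMap.ker (T a)) →
      ∃ v ∈ N, T a v = 0 := by
  obtain ⟨r, hr⟩ := (T a₀).rangeRestrict.exists_rightInverse_of_surjective (T a₀).range_rangeRestrict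
  obtain ⟨S, hS⟩ := r.exists_extend
  have hTST : ∀ v, T a₀ (S (T a₀ v)) = T a₀ v := by
    intro v
    have h1 : S (T a₀ v) = r ((T a₀).rangeRestrict v) := by rw [← hS]; rfl
    rw [h1]
    exact congrArg Subtype.val (LinearMap.congr_fun hr ((T a₀).rangeRestrict v))
  let Φ : α → V →ₗ[ℝ] V := fun a => LinearMap.id - S ∘ₗ T a₀ + S ∘ₗ T a
  have hΦc : ∀ v, Continuous fun a => Φ a v := by
    intro v
    have : Continuous fun a => v - S (T a₀ v) + S (T a v) :=
      continuous_const.add (S.continuous_of_finiteDimensional.comp (hT v))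
    exact this
  have hΦ0 : Φ a₀ = LinearMap.id := by simp [Φ]
  let b := finBasis ℝ V
  let N' : α → Matrix (Fin (finrank ℝ V)) (Fin (finrank ℝ V)) ℝ := fun a => LinearMap.toMatrix b b (Φ a)
  have hN'c : Continuous N' := by
    refine continuous_matrix fun i j => ?_
    have : Continuous fun a => b.coord i (Φ a (b j)) :=
      (b.coord i).continuous_of_finiteDimensional.comp (hΦc _)
    simpa [N', LinearMap.toMatrix_apply] using this
  have hN'0 : N' a₀ = 1 := by simp [N', hΦ0]
  have hu0 : IsUnit (N' a₀).det := by simp [hN'0]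
  have hu : ∀ᶠ a in 𝓝 a₀, IsUnit (N' a).det :=
    hN'c.continuousAt.eventually (Matrix.eventually_isUnit_det hu0)
  let L : Matrix (Fin (finrank ℝ V)) (Fin (finrank ℝ V)) ℝ →ₗ[ℝ] V :=
    LinearMap.applyₗ v₀ ∘ₗ (Matrix.toLin b b).toLinearMap
  let w : α → V := fun a => L (N' a)⁻¹
  have hw0 : w a₀ = v₀ := by simp [w, L, hN'0]
  have hw : ContinuousAt w a₀ := by
    have h1 : ContinuousAt (fun a => (N' a)⁻¹) a₀ :=
      ContinuousAt.comp (f := N') (Matrix.continuousAt_inv_of_isUnit_det hu0) hN'c.continuousAt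
    have h2 : Continuous L := L.continuous_of_finiteDimensional
    exact ContinuousAt.comp (f := fun a => (N' a)⁻¹) (g := L) h2.continuousAt h1
  have hwN : ∀ᶠ a in 𝓝 a₀, w a ∈ N := hw.eventually (by rw [hw0]; exact hN)
  filter_upwards [hu, hwN] with a hua hwa hdim
  refine ⟨w a, hwa, ?_⟩
  have hinv : ∀ v, Matrix.toLin b b (N' a)⁻¹ (Φ a v) = v := by
    intro v
    have h1 : Φ a = Matrix.toLin b b (N' a) := by simp [N']
    rw [h1, ← LinearMap.comp_apply, ← Matrix.toLin_mul, Matrix.nonsing_inv_mul _ hua]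
    simp
  have hmaps : ∀ v ∈ LinearMap.ker (T a), Φ a v ∈ LinearMap.ker (T a₀) := by
    intro v hv
    rw [LinearMap.mem_ker] at hv ⊢
    simp [Φ, hv, hTST]
  let Ψ := (Φ a).restrict hmaps
  have hinj : Function.Injective Ψ := by
    intro x y hxy
    have := congrArg (fun z => Matrix.toLin b b (N' a)⁻¹ (Subtype.val z)) hxy
    simp only [Ψ, LinearMap.restrict_apply, hinv] at this
    exact Subtype.ext this
  have hsurj : Function.Surjective Ψ :=
    (LinearMap.injective_iff_surjective_of_finrank_eq_finrank
      (le_antisymm (LinearMap.finrank_le_finrank_of_injective hinj) hdim)).1 hinj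
  obtain ⟨x, hx⟩ := hsurj ⟨v₀, hv₀⟩
  have hx' : Φ a x = v₀ := congrArg Subtype.val hx
  have : w a = x := by
    change Matrix.toLin b b (N' a)⁻¹ v₀ = x
    rw [← hx', hinv]
  rw [this]
  exact x.2

variable {n : ℕ} {A : Matrix (Fin n) (Fin n) ℝ}

/-- The invertible matrices commuting with `A`. -/
def unitCentralizer (A : Matrix (Fin n) (Fin n) ℝ) : Set (Matrix (Fin n) (Fin n) ℝ) :=
  {X | Commute X A ∧ IsUnit X.det}

theorem eventually_exists_conj {G₀ : Matrix (Fin n) (Fin n) ℝ} (hG₀ : IsUnit G₀.det)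
    {N : Set (Matrix (Fin n) (Fin n) ℝ)} (hN : N ∈ 𝓝 G₀) :
    ∀ᶠ M in 𝓝 (G₀⁻¹ * A * G₀), (∃ G, IsUnit G.det ∧ G⁻¹ * A * G = M) →
      ∃ G ∈ N, IsUnit G.det ∧ G⁻¹ * A * G = M := by
  let T : Matrix (Fin n) (Fin n) ℝ → Matrix (Fin n) (Fin n) ℝ →ₗ[ℝ] Matrix (Fin n) (Fin n) ℝ :=
    fun M => LinearMap.mulRight ℝ M - LinearMap.mulLeft ℝ A
  have hT : ∀ X, Continuous fun M => T M X := by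
    intro X
    have : Continuous fun M : Matrix (Fin n) (Fin n) ℝ => X * M - A * X := by fun_prop
    exact this
  have hT0 : T (G₀⁻¹ * A * G₀) G₀ = 0 := by
    simp [T, Matrix.mul_nonsing_inv _ hG₀]
  filter_upwards [LinearMap.eventually_exists_ker_mem hT hT0
    (inter_mem hN (Matrix.eventually_isUnit_det hG₀))] with M hM hconj
  obtain ⟨K, hK, hKM⟩ := hconj
  obtain ⟨G, ⟨hGN, hGu⟩, hG⟩ := hM (by
    have hmaps : ∀ X ∈ LinearMap.ker (T (G₀⁻¹ * A * G₀)),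
        LinearMap.mulRight ℝ (G₀⁻¹ * K) X ∈ LinearMap.ker (T M) := by
      intro X hX
      have hX' : X * (G₀⁻¹ * A * G₀) = A * X := sub_eq_zero.1 hX
      rw [LinearMap.mem_ker]
      refine sub_eq_zero.2 ?_
      simp only [LinearMap.mulRight_apply, LinearMap.mulLeft_apply, ← hKM]
      calc X * (G₀⁻¹ * K) * (K⁻¹ * A * K) = X * (G₀⁻¹ * (K * K⁻¹) * A * (G₀ * G₀⁻¹) * K) := by
            rw [Matrix.mul_nonsing_inv _ hG₀, Matrix.mul_one]
            simp only [Matrix.mul_assoc]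
        _ = X * (G₀⁻¹ * A * G₀) * (G₀⁻¹ * K) := by
            rw [Matrix.mul_nonsing_inv _ hK, Matrix.mul_one]
            simp only [Matrix.mul_assoc]
        _ = _ := by rw [hX']; simp only [Matrix.mul_assoc]
    refine LinearMap.finrank_le_finrank_of_injective
      (f := (LinearMap.mulRight ℝ (G₀⁻¹ * K)).restrict hmaps) ?_
    intro X Y hxy
    have h : X.1 * (G₀⁻¹ * K) * (K⁻¹ * G₀) = Y.1 * (G₀⁻¹ * K) * (K⁻¹ * G₀) :=
      congrArg (fun z => Subtype.val z * (K⁻¹ * G₀)) hxy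
    have h1 : G₀⁻¹ * K * (K⁻¹ * G₀) = 1 := by
      rw [Matrix.mul_assoc, ← Matrix.mul_assoc K, Matrix.mul_nonsing_inv _ hK, Matrix.one_mul,
        Matrix.nonsing_inv_mul _ hG₀]
    simp only [Matrix.mul_assoc X.1, Matrix.mul_assoc Y.1, h1, Matrix.mul_one] at h
    exact Subtype.ext h)
  refine ⟨G, hGN, hGu, ?_⟩
  have hG' : G * M = A * G := sub_eq_zero.1 hG
  rw [Matrix.mul_assoc, ← hG', ← Matrix.mul_assoc, Matrix.nonsing_inv_mul _ hGu, Matrix.one_mul]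

theorem conj_mul_eq {z : Matrix (Fin n) (Fin n) ℝ} (hz : z ∈ unitCentralizer A)
    (G : Matrix (Fin n) (Fin n) ℝ) : (z * G)⁻¹ * A * (z * G) = G⁻¹ * A * G := by
  rw [Matrix.mul_inv_rev]
  calc G⁻¹ * z⁻¹ * A * (z * G) = G⁻¹ * (z⁻¹ * (A * z)) * G := by simp only [Matrix.mul_assoc]
    _ = G⁻¹ * (z⁻¹ * z * A) * G := by rw [← hz.1.eq, Matrix.mul_assoc z⁻¹]
    _ = _ := by rw [Matrix.nonsing_inv_mul _ hz.2, Matrix.one_mul]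

theorem mul_mem_conjDomain {z G : Matrix (Fin n) (Fin n) ℝ} (hz : z ∈ unitCentralizer A)
    (hG : G ∈ conjDomain A) : z * G ∈ conjDomain A := by
  refine ⟨by rw [Matrix.det_mul]; exact hz.2.mul hG.1, ?_⟩
  rw [conj_mul_eq hz]
  exact hG.2

theorem mul_inv_mem_unitCentralizer {G K : Matrix (Fin n) (Fin n) ℝ} (hG : IsUnit G.det)
    (hK : IsUnit K.det) (h : G⁻¹ * A * G = K⁻¹ * A * K) : G * K⁻¹ ∈ unitCentralizer A := by
  refine ⟨?_, ?_⟩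
  · have h1 : A * G = G * (K⁻¹ * A * K) := by
      rw [← h, ← Matrix.mul_assoc, ← Matrix.mul_assoc, Matrix.mul_nonsing_inv _ hG, Matrix.one_mul]
    have h2 : A * (G * K⁻¹) = G * K⁻¹ * A := by
      rw [← Matrix.mul_assoc, h1]
      simp only [Matrix.mul_assoc, Matrix.mul_nonsing_inv _ hK, Matrix.mul_one]
    exact h2.symm
  · rw [Matrix.det_mul]
    exact hG.mul ((Matrix.isUnit_nonsing_inv_det _ hK))

theorem one_mem_conjDomain (hA : PosEntries A) : 1 ∈ conjDomain A :=
  ⟨by simp, by simpa using hA⟩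

theorem exists_joinedIn_conjDomain {C : Set (Matrix (Fin n) (Fin n) ℝ)} (hC : IsPreconnected C)
    (hAC : A ∈ C) (hCA : ∀ M ∈ C, PosEntries M ∧ ∃ G, IsUnit G.det ∧ G⁻¹ * A * G = M) :
    ∀ M ∈ C, ∃ G, G⁻¹ * A * G = M ∧ JoinedIn (conjDomain A) 1 G := by
  have : LocallyPathConnectedSpace (Matrix (Fin n) (Fin n) ℝ) :=
    inferInstanceAs (LocallyPathConnectedSpace (Fin n → Fin n → ℝ))
  have htrans : ∀ {z G G' : Matrix (Fin n) (Fin n) ℝ}, z ∈ unitCentralizer A →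
      JoinedIn (conjDomain A) G G' → JoinedIn (conjDomain A) (z * G) (z * G') := by
    rintro z G G' hz ⟨γ, hγ⟩
    exact ⟨γ.map (continuous_const_mul z), fun t => mul_mem_conjDomain hz (hγ t)⟩
  have hmem : ∀ {G}, IsUnit G.det → G⁻¹ * A * G ∈ C → G ∈ conjDomain A :=
    fun hG hGC => ⟨hG, (hCA _ hGC).1⟩
  intro M hM
  refine hC.induction₂ (fun M M' => ∀ G, IsUnit G.det → G⁻¹ * A * G = M →
    ∃ G', G'⁻¹ * A * G' = M' ∧ JoinedIn (conjDomain A) G G') ?_ ?_ ?_ hAC hM 1 (by simp) (by simp)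
  · intro M hM
    obtain ⟨K, hK, rfl⟩ := (hCA M hM).2
    have hN : pathComponentIn (conjDomain A) K ∈ 𝓝 K :=
      ((isOpen_conjDomain A).pathComponentIn K).mem_nhds (mem_pathComponentIn_self (hmem hK hM))
    filter_upwards [mem_nhdsWithin_of_mem_nhds (eventually_exists_conj hK hN), self_mem_nhdsWithin]
      with M' h1 h2 G hG hGK
    obtain ⟨G', hG', -, rfl⟩ := h1 (hCA M' h2).2
    have hz := mul_inv_mem_unitCentralizer hG hK hGK
    refine ⟨G * K⁻¹ * G', conj_mul_eq hz _, ?_⟩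
    have := htrans hz hG'
    rwa [Matrix.mul_assoc G, Matrix.nonsing_inv_mul _ hK, Matrix.mul_one] at this
  · intro M₁ M₂ M₃ h1 _ _ h12 h23 G hG hGM
    obtain ⟨G', hG', hj⟩ := h12 G hG hGM
    obtain ⟨G'', hG'', hj'⟩ := h23 G' hj.target_mem.1 hG'
    exact ⟨G'', hG'', hj.trans hj'⟩
  · intro M₁ M₂ h1 _ h12 G hG hGM
    obtain ⟨K, hK, hKM⟩ := (hCA M₁ h1).2
    obtain ⟨G', hG', hj⟩ := h12 K hK hKM
    have hz := mul_inv_mem_unitCentralizer hG hj.target_mem.1 (hGM.trans hG'.symm)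
    refine ⟨G * G'⁻¹ * K, (conj_mul_eq hz _).trans hKM, ?_⟩
    have := htrans hz hj.symm
    rwa [Matrix.mul_assoc G, Matrix.nonsing_inv_mul _ hj.target_mem.1, Matrix.mul_one] at this

end Lifting

section Structure

open Polynomial Module

variable {n : ℕ}

/-- A decomposition of `ℝⁿ`, as a module over `ℝ[X]` through `A`, into cyclic submodules of prime
power order, given by the projections onto the summands. -/
structure CyclicDecomposition (A : Matrix (Fin n) (Fin n) ℝ) where
  /-- The index type of the summands. -/
  ι : Type
  [fintype : Fintype ι]
  [decidableEq : DecidableEq ι]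
  /-- The prime belonging to a summand. -/
  p : ι → ℝ[X]
  /-- The exponent of the prime belonging to a summand. -/
  e : ι → ℕ
  /-- The projection onto a summand. -/
  E : ι → Matrix (Fin n) (Fin n) ℝ
  irreducible (i : ι) : Irreducible (p i)
  commute (i : ι) : Commute (E i) A
  mul_self (i : ι) : E i * E i = E i
  mul_of_ne (i j : ι) : i ≠ j → E i * E j = 0
  sum_eq_one : ∑ i, E i = 1
  exists_aeval (i : ι) (X : Matrix (Fin n) (Fin n) ℝ) : Commute X A →
    ∃ g : ℝ[X], E i * X * E i = aeval A g * E i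
  aeval_mul_eq_zero_iff (i : ι) (g : ℝ[X]) : aeval A g * E i = 0 ↔ p i ^ e i ∣ g
  exists_iso (i j : ι) : Ideal.span {p i ^ e i} = Ideal.span {p j ^ e j} →
    ∃ F F' : Matrix (Fin n) (Fin n) ℝ, Commute F A ∧ Commute F' A ∧ F * F' = E i ∧ F' * F = E j ∧
      E i * F = F ∧ F * E j = F ∧ E j * F' = F' ∧ F' * E i = F'

attribute [instance] CyclicDecomposition.fintype CyclicDecomposition.decidableEq

/-- The matrix of an endomorphism of the `ℝ[X]`-module defined by `A`. -/
noncomputable def aevalEndToMatrix (A : Matrix (Fin n) (Fin n) ℝ) :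
    Module.End ℝ[X] (AEval' (Matrix.toLin' A)) →+* Matrix (Fin n) (Fin n) ℝ where
  toFun g := LinearMap.toMatrix' ((AEval'.of (Matrix.toLin' A)).symm.toLinearMap ∘ₗ
    (g.restrictScalars ℝ) ∘ₗ (AEval'.of (Matrix.toLin' A)).toLinearMap)
  map_one' := by
    rw [← LinearMap.toMatrix'_one]
    congr 1
  map_mul' g h := by
    rw [← LinearMap.toMatrix'_mul]
    congr 1
  map_zero' := by
    rw [← map_zero LinearMap.toMatrix']
    congr 1
  map_add' g h := by
    rw [← map_add]
    congr 1

theorem aevalEndToMatrix_mulVec (A : Matrix (Fin n) (Fin n) ℝ)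
    (g : Module.End ℝ[X] (AEval' (Matrix.toLin' A))) (v : Fin n → ℝ) :
    aevalEndToMatrix A g *ᵥ v =
      (AEval'.of (Matrix.toLin' A)).symm (g (AEval'.of (Matrix.toLin' A) v)) := by
  rw [← Matrix.toLin'_apply]
  simp [aevalEndToMatrix]

theorem aevalEndToMatrix_injective (A : Matrix (Fin n) (Fin n) ℝ) :
    Function.Injective (aevalEndToMatrix A) := by
  intro g h hgh
  ext v
  have := congrArg (fun X => X *ᵥ (AEval'.of (Matrix.toLin' A)).symm v) hgh
  simpa [aevalEndToMatrix_mulVec] using this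

theorem aevalEndToMatrix_smul (A : Matrix (Fin n) (Fin n) ℝ) (q : ℝ[X])
    (g : Module.End ℝ[X] (AEval' (Matrix.toLin' A))) :
    aevalEndToMatrix A (q • g) = aeval A q * aevalEndToMatrix A g := by
  refine Matrix.ext_of_mulVec_single fun i => ?_
  rw [← Matrix.mulVec_mulVec, aevalEndToMatrix_mulVec, aevalEndToMatrix_mulVec,
    LinearMap.smul_apply]
  rw [AEval.of_symm_smul]
  have : aeval (Matrix.toLin' A) q = Matrix.toLin' (aeval A q) :=
    (Polynomial.aeval_algHom_apply (Matrix.toLinAlgEquiv' (R := ℝ) (n := Fin n)).toAlgHom A q)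
  rw [this, Module.End.smul_def, Matrix.toLin'_apply]

theorem commute_aevalEndToMatrix (A : Matrix (Fin n) (Fin n) ℝ)
    (g : Module.End ℝ[X] (AEval' (Matrix.toLin' A))) : Commute (aevalEndToMatrix A g) A := by
  have h : aevalEndToMatrix A ((X : ℝ[X]) • 1) = A := by
    rw [aevalEndToMatrix_smul, map_one, aeval_X, mul_one]
  have : Commute g ((X : ℝ[X]) • (1 : Module.End ℝ[X] (AEval' (Matrix.toLin' A)))) :=
    (Commute.one_right g).smul_right _
  simpa [h] using this.map (aevalEndToMatrix A)

theorem exists_aevalEndToMatrix_eq {A Y : Matrix (Fin n) (Fin n) ℝ} (hY : Commute Y A) :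
    ∃ g, aevalEndToMatrix A g = Y := by
  let g : Module.End ℝ[X] (AEval' (Matrix.toLin' A)) :=
    LinearMap.ofAEval _ ((AEval'.of (Matrix.toLin' A)).toLinearMap ∘ₗ Matrix.toLin' Y) (by
      intro m
      simp [AEval'.X_smul_of, hY.eq])
  refine ⟨g, Matrix.ext_of_mulVec_single fun i => ?_⟩
  rw [aevalEndToMatrix_mulVec]
  rfl

theorem nonempty_cyclicDecomposition (A : Matrix (Fin n) (Fin n) ℝ) :
    Nonempty (CyclicDecomposition A) := by
  classical
  obtain ⟨ι, _, p, hp, e, ⟨φ⟩⟩ := Module.equiv_directSum_of_isTorsion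
    (Module.AEval.isTorsion_of_finiteDimensional ℝ (Fin n → ℝ) (Matrix.toLin' A))
  let I : ι → Ideal ℝ[X] := fun i => Ideal.span {p i ^ e i}
  let ψ : AEval' (Matrix.toLin' A) ≃ₗ[ℝ[X]] (∀ i, ℝ[X] ⧸ I i) :=
    φ.trans (DirectSum.linearEquivFunOnFintype ℝ[X] ι fun i => ℝ[X] ⧸ I i)
  let u : ∀ i, (ℝ[X] ⧸ I i) →ₗ[ℝ[X]] AEval' (Matrix.toLin' A) := fun i =>
    ψ.symm.toLinearMap ∘ₗ LinearMap.single ℝ[X] (fun i => ℝ[X] ⧸ I i) i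
  let v : ∀ i, AEval' (Matrix.toLin' A) →ₗ[ℝ[X]] (ℝ[X] ⧸ I i) := fun i =>
    LinearMap.proj i ∘ₗ ψ.toLinearMap
  have hvu : ∀ i x, v i (u i x) = x := fun i x => by simp [u, v]
  have hvu' : ∀ i j x, i ≠ j → v i (u j x) = 0 := fun i j x hij => by simp [u, v, hij]
  have hsum : ∀ x, ∑ i, u i (v i x) = x := fun x => by
    simp only [u, v, LinearMap.comp_apply, ← map_sum, LinearEquiv.coe_coe]
    rw [LinearEquiv.symm_apply_eq]
    ext i
    simp [Finset.sum_apply]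
  have hsm : ∀ i (q : ℝ[X]), q • (1 : ℝ[X] ⧸ I i) = Ideal.Quotient.mk (I i) q := by
    intro i q
    change (Submodule.Quotient.mk (q * 1) : ℝ[X] ⧸ I i) = Submodule.Quotient.mk q
    rw [mul_one]
  have hmk : ∀ i (x : ℝ[X] ⧸ I i), ∃ q : ℝ[X], x = q • (1 : ℝ[X] ⧸ I i) := by
    intro i x
    obtain ⟨q, rfl⟩ := Ideal.Quotient.mk_surjective x
    exact ⟨q, (hsm i q).symm⟩
  have hmk0 : ∀ i (q : ℝ[X]), q • (1 : ℝ[X] ⧸ I i) = 0 ↔ p i ^ e i ∣ q := by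
    intro i q
    rw [← Ideal.mem_span_singleton, ← Ideal.Quotient.eq_zero_iff_mem, hsm]
  refine ⟨{
    ι := ι
    p := p
    e := e
    irreducible := hp
    E := fun i => aevalEndToMatrix A (u i ∘ₗ v i)
    commute := fun i => commute_aevalEndToMatrix A _
    mul_self := fun i => ?_
    mul_of_ne := fun i j hij => ?_
    sum_eq_one := ?_
    exists_aeval := fun i Y hY => ?_
    aeval_mul_eq_zero_iff := fun i g => ?_
    exists_iso := fun i j hij => ?_ }⟩
  · rw [← map_mul]
    congr 1
    refine LinearMap.ext fun x => ?_
    simp [hvu]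
  · rw [← map_mul, ← map_zero (aevalEndToMatrix A)]
    congr 1
    refine LinearMap.ext fun x => ?_
    simp [hvu' i j _ hij]
  · rw [← map_sum, ← map_one (aevalEndToMatrix A)]
    congr 1
    refine LinearMap.ext fun x => ?_
    simp [hsum]
  · obtain ⟨g, rfl⟩ := exists_aevalEndToMatrix_eq hY
    obtain ⟨q, hq⟩ := hmk i (v i (g (u i 1)))
    refine ⟨q, ?_⟩
    rw [← map_mul, ← map_mul, ← aevalEndToMatrix_smul]
    congr 1
    refine LinearMap.ext fun x => ?_
    obtain ⟨r, hr⟩ := hmk i (v i x)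
    simp only [Module.End.mul_apply, LinearMap.comp_apply, LinearMap.smul_apply, hr, map_smul, hq]
    rw [smul_comm]
  · rw [← aevalEndToMatrix_smul, ← hmk0, ← map_zero (aevalEndToMatrix A),
      (aevalEndToMatrix_injective A).eq_iff]
    constructor
    · intro h
      have := congrArg (v i) (LinearMap.congr_fun h (u i 1))
      simpa [hvu] using this
    · intro h
      refine LinearMap.ext fun x => ?_
      obtain ⟨r, hr⟩ := hmk i (v i x)
      simp only [LinearMap.smul_apply, LinearMap.comp_apply, hr, ← map_smul]
      rw [smul_comm, h]
      simp
  · let c : (ℝ[X] ⧸ I i) ≃ₗ[ℝ[X]] (ℝ[X] ⧸ I j) := Submodule.quotEquivOfEq _ _ hij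
    refine ⟨aevalEndToMatrix A (u i ∘ₗ c.symm.toLinearMap ∘ₗ v j),
      aevalEndToMatrix A (u j ∘ₗ c.toLinearMap ∘ₗ v i), commute_aevalEndToMatrix A _,
      commute_aevalEndToMatrix A _, ?_, ?_, ?_, ?_, ?_, ?_⟩ <;>
    · rw [← map_mul]
      congr 1
      refine LinearMap.ext fun x => ?_
      simp [hvu]

end Structure

section Components

open Polynomial Module Topology Filter

theorem mul_mul_mul_eq_of_corner_inverse {R : Type*} [Ring R] {x e k : R} (he : e * e = e)
    (hek : e * k = k) (hke : k * e = k) (h1 : k * (e * x * e) = e) (h2 : e * x * e * k = e) :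
    (1 + (1 - e) * x * e * k) *
      (e * x * e + (1 - e) * x * (1 - e) - (1 - e) * x * e * k * (e * x * (1 - e))) *
      (1 + k * (e * x * (1 - e))) = x := by
  have hfe : (1 - e) * e = 0 := by rw [sub_mul, he, one_mul, sub_self]
  have hef : e * (1 - e) = 0 := by rw [mul_sub, he, mul_one, sub_self]
  have hfk : (1 - e) * k = 0 := by rw [← hek, ← mul_assoc, hfe, zero_mul]
  have hkf : k * (1 - e) = 0 := by rw [← hke, mul_assoc, hef, mul_zero]
  have hL : (1 + (1 - e) * x * e * k) *
      (e * x * e + (1 - e) * x * (1 - e) - (1 - e) * x * e * k * (e * x * (1 - e))) =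
      e * x * e + (1 - e) * x * (1 - e) - (1 - e) * x * e * k * (e * x * (1 - e)) +
        (1 - e) * x * e := by
    calc _ = e * x * e + (1 - e) * x * (1 - e) - (1 - e) * x * e * k * (e * x * (1 - e)) +
        (1 - e) * x * e * (k * (e * x * e)) + (1 - e) * x * e * (k * (1 - e)) * x * (1 - e) -
        (1 - e) * x * e * (k * (1 - e)) * x * e * k * (e * x * (1 - e)) := by
          simp only [mul_add, add_mul, mul_sub, mul_assoc, one_mul, sub_mul, mul_one]
          abel
      _ = _ := by rw [hkf, h1, mul_assoc _ e e, he]; simp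
  rw [hL]
  calc _ = e * x * e + (1 - e) * x * (1 - e) - (1 - e) * x * e * k * (e * x * (1 - e)) +
        (1 - e) * x * e + e * x * e * k * (e * x * (1 - e)) +
        (1 - e) * x * ((1 - e) * k) * (e * x * (1 - e)) -
        (1 - e) * x * e * k * e * x * ((1 - e) * k) * (e * x * (1 - e)) +
        (1 - e) * x * e * k * (e * x * (1 - e)) := by
          simp only [mul_add, add_mul, mul_sub, mul_assoc, one_mul, sub_mul, mul_one]
          abel
    _ = e * x * e + (1 - e) * x * (1 - e) + (1 - e) * x * e + e * x * (1 - e) := by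
          rw [hfk, h2, ← mul_assoc e (e * x), ← mul_assoc e e, he]
          simp only [mul_zero, zero_mul]
          abel
    _ = x := by noncomm_ring

variable {n : ℕ} {A : Matrix (Fin n) (Fin n) ℝ}

theorem one_mem_unitCentralizer : 1 ∈ unitCentralizer A := ⟨Commute.one_left A, by simp⟩

theorem mul_mem_unitCentralizer {X Y : Matrix (Fin n) (Fin n) ℝ} (hX : X ∈ unitCentralizer A)
    (hY : Y ∈ unitCentralizer A) : X * Y ∈ unitCentralizer A :=
  ⟨hX.1.mul_left hY.1, by rw [Matrix.det_mul]; exact hX.2.mul hY.2⟩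

theorem neg_mem_unitCentralizer {X : Matrix (Fin n) (Fin n) ℝ} (hX : X ∈ unitCentralizer A) :
    -X ∈ unitCentralizer A :=
  ⟨hX.1.neg_left, by rw [Matrix.det_neg]; exact (IsUnit.pow _ (by simp)).mul hX.2⟩

theorem mem_unitCentralizer_of_mul_eq_one {X Y : Matrix (Fin n) (Fin n) ℝ} (hX : Commute X A)
    (h : X * Y = 1) : X ∈ unitCentralizer A := ⟨hX, Matrix.isUnit_det_of_right_inverse h⟩

theorem Matrix.commute_inv_left {X Y : Matrix (Fin n) (Fin n) ℝ} (hX : IsUnit X.det)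
    (h : Commute X Y) : Commute X⁻¹ Y := by
  change X⁻¹ * Y = Y * X⁻¹
  calc X⁻¹ * Y = X⁻¹ * (Y * X) * X⁻¹ := by
        rw [Matrix.mul_assoc, Matrix.mul_assoc, Matrix.mul_nonsing_inv _ hX, Matrix.mul_one]
    _ = _ := by rw [← h.eq, ← Matrix.mul_assoc, Matrix.nonsing_inv_mul _ hX, Matrix.one_mul]

theorem JoinedIn.unitCentralizer_mul {X Y X' Y' : Matrix (Fin n) (Fin n) ℝ}
    (h : JoinedIn (unitCentralizer A) X Y) (h' : JoinedIn (unitCentralizer A) X' Y') :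
    JoinedIn (unitCentralizer A) (X * X') (Y * Y') := by
  obtain ⟨γ, hγ⟩ := h
  obtain ⟨γ', hγ'⟩ := h'
  refine ⟨⟨⟨fun t => γ t * γ' t, by fun_prop⟩, by simp, by simp⟩, fun t => ?_⟩
  exact mul_mem_unitCentralizer (hγ t) (hγ' t)

theorem JoinedIn.unitCentralizer_neg {X Y : Matrix (Fin n) (Fin n) ℝ}
    (h : JoinedIn (unitCentralizer A) X Y) : JoinedIn (unitCentralizer A) (-X) (-Y) := by
  have := (JoinedIn.refl (neg_mem_unitCentralizer (one_mem_unitCentralizer (A := A)))).unitCentralizer_mul h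
  simpa using this

theorem joinedIn_unitCentralizer_of_continuous {f : ℝ → Matrix (Fin n) (Fin n) ℝ}
    (hf : Continuous f) (h : ∀ t, 0 ≤ t → t ≤ 1 → f t ∈ unitCentralizer A) :
    JoinedIn (unitCentralizer A) (f 0) (f 1) := by
  refine JoinedIn.ofLine hf.continuousOn rfl rfl ?_
  rintro _ ⟨t, ht, rfl⟩
  exact h t ht.1 ht.2

theorem exists_pos_isUnit_det_corner {X e : Matrix (Fin n) (Fin n) ℝ} (hX : IsUnit X.det)
    (he : e * e = e) : ∃ t : ℝ, 0 < t ∧ (∀ s, 0 ≤ s → s ≤ t → IsUnit (X + s • 1).det) ∧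
      IsUnit (e * (X + t • 1) * e + (1 - e)).det := by
  have h1 : ∀ᶠ s in 𝓝 (0 : ℝ), IsUnit (X + s • (1 : Matrix (Fin n) (Fin n) ℝ)).det := by
    have hc : Continuous fun s : ℝ => X + s • (1 : Matrix (Fin n) (Fin n) ℝ) := by fun_prop
    exact (hc.tendsto' 0 X (by simp)).eventually (Matrix.eventually_isUnit_det hX)
  obtain ⟨δ, hδ, hball⟩ := Metric.eventually_nhds_iff.1 h1
  have hfin : {t : ℝ | (-(e * X * e)).charpoly.IsRoot t}.Finite :=
    Polynomial.finite_setOfPred_isRoot (Matrix.charpoly_monic _).ne_zero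
  obtain ⟨t, ht, ht'⟩ := ((Set.Ioo_infinite hδ).sdiff hfin).nonempty
  refine ⟨t, ht.1, fun s hs hst => hball ?_, ?_⟩
  · rw [Real.dist_eq, sub_zero, abs_of_nonneg hs]
    exact hst.trans_lt ht.2
  · have h2 : (t • (1 : Matrix (Fin n) (Fin n) ℝ) + e * X * e).det ≠ 0 := by
      intro h0
      apply ht'
      rw [Set.mem_ofPred_eq, Polynomial.IsRoot, Matrix.eval_charpoly, sub_neg_eq_add, ← h0]
      congr 2
      ext i j
      simp [Matrix.smul_apply, Matrix.one_apply, Matrix.diagonal_apply, Matrix.scalar_apply]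
    have h3 : t • (1 : Matrix (Fin n) (Fin n) ℝ) + e * X * e =
        (e * (X + t • 1) * e + (1 - e)) * (e + t • (1 - e)) := by
      have : e * X * e * e = e * X * e := by rw [Matrix.mul_assoc _ e e, he]
      simp only [mul_add, add_mul, mul_sub, sub_mul, Matrix.mul_smul, Matrix.smul_mul, mul_one,
        one_mul, he, this, smul_sub]
      abel
    rw [h3, Matrix.det_mul] at h2
    exact isUnit_iff_ne_zero.2 (left_ne_zero_of_mul h2)

theorem joinedIn_one_add_smul {N : Matrix (Fin n) (Fin n) ℝ} (hN : Commute N A) (hN2 : N * N = 0) :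
    JoinedIn (unitCentralizer A) (1 + N) 1 := by
  have := joinedIn_unitCentralizer_of_continuous (A := A) (f := fun t => 1 + (1 - t) • N)
    (by fun_prop) fun t _ _ => ?_
  · simpa using this
  · refine mem_unitCentralizer_of_mul_eq_one (Y := 1 - (1 - t) • N)
      ((Commute.one_left A).add_left (hN.smul_left _)) ?_
    simp [mul_sub, add_mul, hN2]

theorem exists_joinedIn_commute {X e : Matrix (Fin n) (Fin n) ℝ} (hX : X ∈ unitCentralizer A)
    (he : e * e = e) (heA : Commute e A) :
    ∃ Y, JoinedIn (unitCentralizer A) X Y ∧ Commute Y e ∧ 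
      ∀ Z, Commute X Z → Commute e Z → Commute Y Z := by
  obtain ⟨t, ht, hs, hu⟩ := exists_pos_isUnit_det_corner hX.2 he
  set x := X + t • (1 : Matrix (Fin n) (Fin n) ℝ) with hx
  have hcx : ∀ Z, Commute X Z → Commute x Z := fun Z hZ =>
    hZ.add_left ((Commute.one_left Z).smul_left t)
  have hXx : JoinedIn (unitCentralizer A) X x := by
    have := joinedIn_unitCentralizer_of_continuous (A := A)
      (f := fun s => X + (s * t) • (1 : Matrix (Fin n) (Fin n) ℝ)) (by fun_prop) fun s h0 h1 =>
        ⟨hX.1.add_left ((Commute.one_left A).smul_left _), hs _ (by positivity)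
          (mul_le_of_le_one_left ht.le h1)⟩
    simpa using this
  set M := e * x * e + (1 - e) with hM
  have hcM : ∀ Z, Commute X Z → Commute e Z → Commute M Z := fun Z h1 h2 =>
    ((h2.mul_left (hcx Z h1)).mul_left h2).add_left ((Commute.one_left Z).sub_left h2)
  have hMe : M * e = e * x * e := by
    rw [hM, add_mul, sub_mul, he, one_mul, sub_self, add_zero, mul_assoc _ e e, he]
  have heM : e * M = e * x * e := by
    rw [hM, mul_add, mul_sub, he, mul_one, sub_self, add_zero, ← mul_assoc, ← mul_assoc, he]
  have hMc : Commute M⁻¹ e := Matrix.commute_inv_left hu (hMe.trans heM.symm)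
  have h1 : M⁻¹ * (e * x * e) = e := by
    rw [← hMe, ← mul_assoc, Matrix.nonsing_inv_mul _ hu, one_mul]
  have h2 : e * x * e * M⁻¹ = e := by
    rw [← heM, mul_assoc, Matrix.mul_nonsing_inv _ hu, mul_one]
  set k := M⁻¹ * e with hk
  have hck : ∀ Z, Commute X Z → Commute e Z → Commute k Z := fun Z h1 h2 =>
    (Matrix.commute_inv_left hu (hcM Z h1 h2)).mul_left h2
  have hke : k * e = k := by rw [hk, mul_assoc, he]
  have hek : e * k = k := by rw [hk, ← mul_assoc, ← hMc.eq, mul_assoc, he]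
  have hkx : k * (e * x * e) = e := by
    rw [hk, hMc.eq, mul_assoc, h1, he]
  have hxk : e * x * e * k = e := by rw [hk, ← mul_assoc, h2, he]
  have key := mul_mul_mul_eq_of_corner_inverse he hek hke hkx hxk
  have hfk : (1 - e) * k = 0 := by rw [sub_mul, one_mul, hek, sub_self]
  have hkf : k * (1 - e) = 0 := by rw [mul_sub, mul_one, hke, sub_self]
  set D := e * x * e + (1 - e) * x * (1 - e) - (1 - e) * x * e * k * (e * x * (1 - e)) with hD
  have hcf : ∀ {Z}, Commute e Z → Commute (1 - e) Z := fun h => (Commute.one_left _).sub_left h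
  have hcD : ∀ Z, Commute X Z → Commute e Z → Commute D Z := fun Z h1 h2 => by
    have hx' := hcx Z h1
    have hf := hcf h2
    exact (((h2.mul_left hx').mul_left h2).add_left ((hf.mul_left hx').mul_left hf)).sub_left
      ((((hf.mul_left hx').mul_left h2).mul_left (hck Z h1 h2)).mul_left
        ((h2.mul_left hx').mul_left hf))
  have hxA := hcx A hX.1
  have hfA := hcf heA
  have hkA := hck A hX.1 heA
  have hL : JoinedIn (unitCentralizer A) (1 + (1 - e) * x * e * k) 1 :=
    joinedIn_one_add_smul (((hfA.mul_left hxA).mul_left heA).mul_left hkA) (by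
      calc _ = (1 - e) * x * e * (k * (1 - e)) * x * e * k := by simp only [mul_assoc]
        _ = 0 := by rw [hkf]; simp)
  have hU : JoinedIn (unitCentralizer A) (1 + k * (e * x * (1 - e))) 1 :=
    joinedIn_one_add_smul (hkA.mul_left ((heA.mul_left hxA).mul_left hfA)) (by
      calc _ = k * e * x * ((1 - e) * k) * (e * x * (1 - e)) := by simp only [mul_assoc]
        _ = 0 := by rw [hfk]; simp)
  have hDu : IsUnit D.det := by
    have h3 := hXx.target_mem.2
    rw [← key, Matrix.det_mul, Matrix.det_mul] at h3
    exact isUnit_of_mul_isUnit_right (isUnit_of_mul_isUnit_left h3)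
  refine ⟨D, ?_, ?_, hcD⟩
  · have := (hL.unitCentralizer_mul (JoinedIn.refl ⟨hcD A hX.1 heA, hDu⟩)).unitCentralizer_mul hU
    rw [key, one_mul, mul_one] at this
    exact hXx.trans this
  · have hfe : (1 - e) * e = 0 := by rw [sub_mul, he, one_mul, sub_self]
    have hef : e * (1 - e) = 0 := by rw [mul_sub, he, mul_one, sub_self]
    change D * e = e * D
    have e1 : D * e = e * x * e := by
      calc D * e = e * x * (e * e) + (1 - e) * x * ((1 - e) * e) -
          (1 - e) * x * e * k * (e * x * ((1 - e) * e)) := by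
            simp only [hD, sub_mul, add_mul, mul_assoc]
        _ = _ := by rw [hfe, he]; simp
    have e2 : e * D = e * x * e := by
      rw [hD]
      generalize 1 - e = f at hef ⊢
      calc _ = (e * e) * x * e + (e * f) * x * f - (e * f) * x * e * k * (e * x * f) := by
            simp only [mul_sub, mul_add, mul_assoc]
        _ = _ := by rw [hef, he]; simp
    rw [e1, e2]

end Components

section Reflections

open Polynomial Module Topology Filter

variable {n : ℕ} {A : Matrix (Fin n) (Fin n) ℝ}

namespace CyclicDecomposition

variable (D : CyclicDecomposition A)

theorem commute_E (i j : D.ι) : Commute (D.E i) (D.E j) := by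
  rcases eq_or_ne i j with rfl | h
  · exact Commute.refl _
  · exact (D.mul_of_ne i j h).trans (D.mul_of_ne j i h.symm).symm

theorem exists_joinedIn_commute_E {X : Matrix (Fin n) (Fin n) ℝ} (hX : X ∈ unitCentralizer A)
    (s : Finset D.ι) :
    ∃ Y, JoinedIn (unitCentralizer A) X Y ∧ ∀ i ∈ s, Commute Y (D.E i) := by
  induction s using Finset.induction_on with
  | empty => exact ⟨X, JoinedIn.refl hX, by simp⟩
  | insert j s _ ih =>
    obtain ⟨Y, hXY, hY⟩ := ih
    obtain ⟨Y', hYY', hY'j, hY'⟩ := exists_joinedIn_commute hXY.target_mem (D.mul_self j) (D.commute j)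
    refine ⟨Y', hXY.trans hYY', ?_⟩
    simp only [Finset.mem_insert, forall_eq_or_imp]
    exact ⟨hY'j, fun i hi => hY' _ (hY i hi) (D.commute_E j i)⟩

theorem commute_aeval {X : Matrix (Fin n) (Fin n) ℝ} (h : Commute X A) (g : ℝ[X]) :
    Commute (aeval A g) X := by
  induction g using Polynomial.induction_on' with
  | add p q hp hq => rw [map_add]; exact hp.add_left hq
  | monomial k c =>
    rw [aeval_monomial]
    exact (Algebra.commute_algebraMap_left c X).mul_left (h.symm.pow_left k)

theorem corner_mul_corner (i : D.ι) {X Y : Matrix (Fin n) (Fin n) ℝ} (hY : Commute Y (D.E i)) :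
    (1 - D.E i + X * D.E i) * (1 - D.E i + Y * D.E i) = 1 - D.E i + X * Y * D.E i := by
  have h := D.mul_self i
  have h1 : X * D.E i * (Y * D.E i) = X * Y * D.E i := by
    rw [Matrix.mul_assoc, ← Matrix.mul_assoc (D.E i), ← hY.eq, Matrix.mul_assoc Y, h,
      ← Matrix.mul_assoc]
  have h2 : D.E i * (Y * D.E i) = Y * D.E i := by
    rw [← Matrix.mul_assoc, ← hY.eq, Matrix.mul_assoc, h]
  simp only [mul_add, add_mul, mul_sub, sub_mul, mul_one, one_mul, h, h1, h2, Matrix.mul_assoc X]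
  abel

theorem corner_mem_unitCentralizer (i : D.ι) {g : ℝ[X]} (hg : IsCoprime g (D.p i ^ D.e i)) :
    1 - D.E i + aeval A g * D.E i ∈ unitCentralizer A := by
  have hE := D.commute i
  obtain ⟨a, b, hab⟩ := hg
  refine mem_unitCentralizer_of_mul_eq_one (Y := 1 - D.E i + aeval A a * D.E i)
    (((Commute.one_left A).sub_left hE).add_left ((commute_aeval (Commute.refl A) g).mul_left hE)) ?_
  have h1 : Commute (aeval A a) (D.E i) :=
    commute_aeval hE a
  rw [D.corner_mul_corner i h1, ← map_mul]
  have h2 : aeval A (g * a) * D.E i = D.E i := by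
    have h3 : aeval A (g * a - 1) * D.E i = 0 := by
      rw [D.aeval_mul_eq_zero_iff]
      exact ⟨-b, by linear_combination hab⟩
    rw [map_sub, map_one, sub_mul, one_mul] at h3
    exact sub_eq_zero.1 h3
  rw [h2, sub_add_cancel]

theorem joinedIn_corner (i : D.ι) {g h : ℝ[X]}
    (hgh : ∀ t : ℝ, 0 ≤ t → t ≤ 1 → IsCoprime (C (1 - t) * g + C t * h) (D.p i ^ D.e i)) :
    JoinedIn (unitCentralizer A) (1 - D.E i + aeval A g * D.E i) (1 - D.E i + aeval A h * D.E i) := by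
  have := joinedIn_unitCentralizer_of_continuous (A := A)
    (f := fun t => 1 - D.E i + ((1 - t) • aeval A g + t • aeval A h) * D.E i) (by fun_prop)
    fun t h0 h1 => ?_
  · simpa using this
  · convert D.corner_mem_unitCentralizer i (hgh t h0 h1)
    simp [Algebra.smul_def]

theorem isCoprime_pow_of_not_dvd (i : D.ι) {g : ℝ[X]} (h : ¬ D.p i ∣ g) :
    IsCoprime g (D.p i ^ D.e i) :=
  (((D.irreducible i).coprime_iff_not_dvd).2 h).symm.pow_right

/-- The summand `i` is nonzero and belongs to a real eigenvalue. -/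
def IsReal (i : D.ι) : Prop := D.e i ≠ 0 ∧ ∃ r, (D.p i).IsRoot r

theorem E_eq_zero (i : D.ι) (h : D.e i = 0) : D.E i = 0 := by
  have := (D.aeval_mul_eq_zero_iff i 1).2 (by simp [h])
  simpa using this

theorem joinedIn_corner_one_of_not_isReal (i : D.ι) (hi : ¬ D.IsReal i) {g : ℝ[X]}
    (hg : IsCoprime g (D.p i ^ D.e i)) :
    JoinedIn (unitCentralizer A) (1 - D.E i + aeval A g * D.E i) 1 := by
  by_cases he : D.e i = 0
  · simpa [D.E_eq_zero i he] using JoinedIn.refl one_mem_unitCentralizer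
  have hroot : ∀ r, ¬ (D.p i).IsRoot r := by simpa [IsReal, he] using hi
  have hdeg : 1 < (D.p i).natDegree := by
    have h0 := (D.irreducible i).natDegree_pos
    by_contra hlt
    have h1 : (D.p i).natDegree = 1 := by omega
    obtain ⟨r, hr⟩ := Polynomial.exists_root_of_degree_eq_one
      ((Polynomial.degree_eq_iff_natDegree_eq_of_pos one_pos).2 h1)
    exact hroot r hr
  have hlin : ∀ a b : ℝ, a ≠ 0 ∨ b ≠ 0 → ¬ D.p i ∣ C a + C b * X := by
    intro a b hab hdvd
    have hne : (C a + C b * X : ℝ[X]) ≠ 0 := by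
      intro h
      have h0 := congrArg (fun q => coeff q 0) h
      have h1 := congrArg (fun q => coeff q 1) h
      simp [coeff_C] at h0 h1
      tauto
    have h2 := Polynomial.natDegree_le_of_dvd hdvd hne
    have h3 : (C a + C b * X : ℝ[X]).natDegree ≤ 1 := by
      rw [add_comm]; exact Polynomial.natDegree_linear_le
    omega
  have hndvd : ¬ D.p i ∣ g := by
    intro h
    exact (D.irreducible i).not_isUnit (hg.isUnit_of_dvd' h (dvd_pow_self _ he))
  suffices h : JoinedIn (unitCentralizer A) (1 - D.E i + aeval A g * D.E i)
      (1 - D.E i + aeval A (1 : ℝ[X]) * D.E i) by simpa using h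
  by_cases hc : ∃ c : ℝ, D.p i ∣ g - C c
  · obtain ⟨c, hc⟩ := hc
    have hc0 : c ≠ 0 := by
      rintro rfl
      exact hndvd (by simpa using hc)
    refine (D.joinedIn_corner i (g := g) (h := X) fun t _ _ => ?_).trans ?_
    · refine D.isCoprime_pow_of_not_dvd i fun h => ?_
      refine hlin ((1 - t) * c) t ?_ ?_
      · by_contra! h'
        simp_all
      · have h4 := dvd_sub h (hc.mul_left (C (1 - t)))
        convert h4 using 1
        rw [C_mul]
        ring
    · refine D.joinedIn_corner i fun t _ _ => D.isCoprime_pow_of_not_dvd i fun h =>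
        hlin t (1 - t) ?_ ?_
      · by_contra! h'
        linarith [h'.1, h'.2]
      · convert h using 1
        ring
  · refine D.joinedIn_corner i fun t _ _ => D.isCoprime_pow_of_not_dvd i fun h => ?_
    by_cases ht : 1 - t = 0
    · have ht1 : t = 1 := by linarith
      refine hlin 1 0 (by simp) ?_
      simpa [ht1] using h
    · refine hc ⟨-(t / (1 - t)), ?_⟩
      have h4 := h.mul_left (C (1 - t)⁻¹)
      convert h4 using 1
      rw [mul_add, ← mul_assoc, ← C_mul, inv_mul_cancel₀ ht, mul_one, ← C_mul, C_neg, div_eq_inv_mul]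
      simp

theorem joinedIn_corner_of_isRoot (i : D.ι) (he : D.e i ≠ 0) {r : ℝ} (hr : (D.p i).IsRoot r)
    {g : ℝ[X]} (hg : IsCoprime g (D.p i ^ D.e i)) :
    JoinedIn (unitCentralizer A) (1 - D.E i + aeval A g * D.E i) 1 ∨
      JoinedIn (unitCentralizer A) (1 - D.E i + aeval A g * D.E i) (1 - (2 : ℝ) • D.E i) := by
  have hgr : g.eval r ≠ 0 := by
    intro h0
    obtain ⟨a, b, hab⟩ := hg
    have := congrArg (Polynomial.eval r) hab
    simp [h0, hr.eq_zero, he] at this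
  have hnd : ∀ h : ℝ[X], h.eval r ≠ 0 → ¬ D.p i ∣ h := by
    rintro _ h ⟨q, rfl⟩
    simp [hr.eq_zero] at h
  rcases lt_or_gt_of_ne hgr with hlt | hgt
  · right
    have := D.joinedIn_corner i (g := g) (h := -1) fun t h0 h1 => ?_
    · convert this using 1
      simp [two_smul]
      abel
    · refine D.isCoprime_pow_of_not_dvd i (hnd _ ?_)
      simp only [eval_add, eval_mul, eval_C, eval_neg, eval_one]
      rcases h0.eq_or_lt with rfl | h0
      · simpa using hgr
      · nlinarith [mul_nonneg (sub_nonneg.2 h1) (neg_nonneg.2 hlt.le)]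
  · left
    have := D.joinedIn_corner i (g := g) (h := 1) fun t h0 h1 => ?_
    · simpa using this
    · refine D.isCoprime_pow_of_not_dvd i (hnd _ ?_)
      simp only [eval_add, eval_mul, eval_C, eval_one]
      rcases h0.eq_or_lt with rfl | h0
      · simpa using hgr
      · nlinarith [mul_nonneg (sub_nonneg.2 h1) hgt.le]

/-- The involution which is `-1` on the summands in `s` and `1` on the others. -/
noncomputable def reflection (s : Finset D.ι) : Matrix (Fin n) (Fin n) ℝ :=
  1 - (2 : ℝ) • ∑ i ∈ s, D.E i

theorem reflection_mul_reflection {s t : Finset D.ι} (hst : Disjoint s t) :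
    D.reflection s * D.reflection t = D.reflection (s ∪ t) := by
  have h : (∑ i ∈ s, D.E i) * ∑ i ∈ t, D.E i = 0 := by
    rw [Finset.sum_mul_sum]
    exact Finset.sum_eq_zero fun i hi => Finset.sum_eq_zero fun j hj =>
      D.mul_of_ne i j (Finset.disjoint_iff_ne.1 hst i hi j hj)
  simp only [reflection, Finset.sum_union hst, mul_sub, sub_mul, mul_one, one_mul, Matrix.mul_smul,
    Matrix.smul_mul, h, smul_add]
  simp
  abel

theorem reflection_mul_self (s : Finset D.ι) : D.reflection s * D.reflection s = 1 := by
  have h : (∑ i ∈ s, D.E i) * ∑ i ∈ s, D.E i = ∑ i ∈ s, D.E i := by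
    rw [Finset.sum_mul_sum]
    refine Finset.sum_congr rfl fun i hi => ?_
    rw [Finset.sum_eq_single i (fun j _ hj => D.mul_of_ne i j hj.symm) (fun h => absurd hi h)]
    exact D.mul_self i
  simp only [reflection, mul_sub, sub_mul, mul_one, one_mul, Matrix.mul_smul, Matrix.smul_mul, h]
  module

theorem commute_reflection (s : Finset D.ι) : Commute (D.reflection s) A :=
  (Commute.one_left A).sub_left ((Commute.sum_left _ _ _ fun i _ => D.commute i).smul_left _)

theorem reflection_mem_unitCentralizer (s : Finset D.ι) : D.reflection s ∈ unitCentralizer A :=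
  mem_unitCentralizer_of_mul_eq_one (D.commute_reflection s) (D.reflection_mul_self s)

theorem neg_reflection (s : Finset D.ι) : -D.reflection s = D.reflection sᶜ := by
  have h := D.sum_eq_one
  rw [← Finset.sum_add_sum_compl s] at h
  have h' : ∑ i ∈ sᶜ, D.E i = 1 - ∑ i ∈ s, D.E i := by rw [← h]; abel
  simp only [reflection, h', two_smul]
  abel

theorem joinedIn_reflection_singleton_one {i : D.ι} (hi : ¬ D.IsReal i) :
    JoinedIn (unitCentralizer A) (D.reflection {i}) 1 := by
  have := D.joinedIn_corner_one_of_not_isReal i hi (g := -1) (isCoprime_one_left.neg_left)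
  convert this using 1
  simp [reflection, two_smul]
  abel

theorem joinedIn_corner_or (i : D.ι) {g : ℝ[X]} (hg : IsCoprime g (D.p i ^ D.e i)) :
    JoinedIn (unitCentralizer A) (1 - D.E i + aeval A g * D.E i) 1 ∨
      JoinedIn (unitCentralizer A) (1 - D.E i + aeval A g * D.E i) (D.reflection {i}) := by
  by_cases hi : D.IsReal i
  · obtain ⟨r, hr⟩ := hi.2
    simpa [reflection] using D.joinedIn_corner_of_isRoot i hi.1 hr hg
  · exact Or.inl (D.joinedIn_corner_one_of_not_isReal i hi hg)

theorem exists_joinedIn_reflection_of_commute (s : Finset D.ι) {Y : Matrix (Fin n) (Fin n) ℝ}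
    (hY : Y ∈ unitCentralizer A) (hYE : ∀ i, Commute Y (D.E i))
    (hYs : ∀ i ∉ s, Y * D.E i = D.E i) :
    ∃ t ⊆ s, JoinedIn (unitCentralizer A) Y (D.reflection t) := by
  induction s using Finset.induction_on generalizing Y with
  | empty =>
    refine ⟨∅, subset_rfl, ?_⟩
    have : Y = 1 := by
      rw [← mul_one Y, ← D.sum_eq_one, Finset.mul_sum]
      exact Finset.sum_congr rfl fun i _ => hYs i (by simp)
    simpa [this, reflection] using JoinedIn.refl one_mem_unitCentralizer
  | insert j s hj ih =>
    have hEY : D.E j * Y * D.E j = Y * D.E j := by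
      rw [← (hYE j).eq, mul_assoc, D.mul_self]
    obtain ⟨g, hg⟩ := D.exists_aeval j Y hY.1
    obtain ⟨h, hh⟩ := D.exists_aeval j Y⁻¹ (Matrix.commute_inv_left hY.2 hY.1)
    have hYi := Matrix.commute_inv_left hY.2 (hYE j)
    have hEYi : D.E j * Y⁻¹ * D.E j = Y⁻¹ * D.E j := by
      rw [← hYi.eq, mul_assoc, D.mul_self]
    rw [hEY] at hg
    rw [hEYi] at hh
    have hcop : IsCoprime g (D.p j ^ D.e j) := by
      have h0 : aeval A (g * h - 1) * D.E j = 0 := by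
        rw [map_sub, map_mul, map_one, sub_mul, one_mul, mul_assoc, ← hh, ← mul_assoc]
        have h1 : aeval A g * Y⁻¹ * D.E j = Y⁻¹ * (aeval A g * D.E j) := by
          rw [(commute_aeval (Matrix.commute_inv_left hY.2 hY.1) g).eq, mul_assoc]
        rw [h1, ← hg, ← mul_assoc, Matrix.nonsing_inv_mul _ hY.2, one_mul, sub_self]
      obtain ⟨c, hc⟩ := (D.aeval_mul_eq_zero_iff j _).1 h0
      exact ⟨h, -c, by linear_combination hc⟩
    set Y' := Y * (1 - D.E j) + D.E j with hY'
    have hYY' : Y = (1 - D.E j + aeval A g * D.E j) * Y' := by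
      rw [← hg]
      have e1 : D.E j * (Y * (1 - D.E j)) = 0 := by
        rw [← mul_assoc, ← (hYE j).eq, mul_assoc, mul_sub, D.mul_self, mul_one, sub_self, mul_zero]
      have e2 : D.E j * Y' = D.E j := by rw [hY', mul_add, e1, zero_add, D.mul_self]
      rw [add_mul, sub_mul, one_mul, mul_assoc, e2, hY', mul_sub, mul_one]
      abel
    have hc' : ∀ Z, Commute Y Z → Commute (D.E j) Z → Commute Y' Z := fun Z h1 h2 =>
      (h1.mul_left ((Commute.one_left Z).sub_left h2)).add_left h2
    have hY'Z : Y' ∈ unitCentralizer A := by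
      refine ⟨hc' A hY.1 (D.commute j), ?_⟩
      have := hY.2
      rw [hYY', Matrix.det_mul] at this
      exact isUnit_of_mul_isUnit_right this
    obtain ⟨t, hts, ht⟩ := ih hY'Z (fun i => hc' _ (hYE i) (D.commute_E j i)) (by
      intro i hi
      rcases eq_or_ne j i with rfl | hij
      · rw [hY', add_mul, mul_assoc, sub_mul, D.mul_self, one_mul, sub_self, mul_zero, zero_add]
      · rw [hY', add_mul, mul_assoc, sub_mul, D.mul_of_ne j i hij, one_mul, sub_zero, add_zero]
        exact hYs i (by simp [hi, hij.symm]))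
    rcases D.joinedIn_corner_or j hcop with h1 | h1
    · refine ⟨t, hts.trans (Finset.subset_insert j s), ?_⟩
      have := h1.unitCentralizer_mul ht
      rwa [← hYY', one_mul] at this
    · refine ⟨insert j t, Finset.insert_subset_insert j hts, ?_⟩
      have := h1.unitCentralizer_mul ht
      rwa [← hYY', D.reflection_mul_reflection
        (Finset.disjoint_singleton_left.2 fun h => hj (hts h))] at this

theorem exists_joinedIn_reflection (i₀ : D.ι) {X : Matrix (Fin n) (Fin n) ℝ}
    (hX : X ∈ unitCentralizer A) : ∃ s : Finset D.ι, i₀ ∉ s ∧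
      (JoinedIn (unitCentralizer A) X (D.reflection s) ∨
        JoinedIn (unitCentralizer A) (-X) (D.reflection s)) := by
  obtain ⟨Y, hXY, hY⟩ := D.exists_joinedIn_commute_E hX Finset.univ
  obtain ⟨s, -, hs⟩ := D.exists_joinedIn_reflection_of_commute Finset.univ hXY.target_mem
    (fun i => hY i (Finset.mem_univ i)) (by simp)
  have hXs := hXY.trans hs
  by_cases h : i₀ ∈ s
  · refine ⟨sᶜ, by simpa using h, Or.inr ?_⟩
    rw [← D.neg_reflection]
    exact hXs.unitCentralizer_neg
  · exact ⟨s, h, Or.inl hXs⟩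

theorem joinedIn_reflection_singleton (i j : D.ι)
    (h : Ideal.span {D.p i ^ D.e i} = Ideal.span {D.p j ^ D.e j}) :
    JoinedIn (unitCentralizer A) (D.reflection {i}) (D.reflection {j}) := by
  rcases eq_or_ne i j with rfl | hij
  · exact JoinedIn.refl (D.reflection_mem_unitCentralizer _)
  obtain ⟨F, F', hF, hF', h1, h2, h3, h4, h5, h6⟩ := D.exists_iso i j h
  have hji := D.mul_of_ne j i hij.symm
  have hij' := D.mul_of_ne i j hij
  have hFi : F * D.E i = 0 := by rw [← h4, mul_assoc, hji, mul_zero]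
  have hjF : D.E j * F = 0 := by rw [← h3, ← mul_assoc, hji, zero_mul]
  have hF'j : F' * D.E j = 0 := by rw [← h6, mul_assoc, hij', mul_zero]
  have hiF' : D.E i * F' = 0 := by rw [← h5, ← mul_assoc, hij', zero_mul]
  have hFF : F * F = 0 := by
    rw [show F * F = F * (D.E i * F) by rw [h3], ← mul_assoc, hFi, zero_mul]
  have hFF' : F' * F' = 0 := by
    rw [show F' * F' = F' * (D.E j * F') by rw [h5], ← mul_assoc, hF'j, zero_mul]
  set P := D.E i + D.E j with hP
  set J := F - F' with hJ
  have hPP : P * P = P := by simp [hP, mul_add, add_mul, D.mul_self, hij', hji]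
  have hPJ : P * J = J := by simp [hP, hJ, add_mul, mul_sub, h3, h5, hjF, hiF']
  have hJP : J * P = J := by simp [hP, hJ, mul_add, sub_mul, h4, h6, hFi, hF'j]; abel
  have hJJ : J * J = -P := by simp [hP, hJ, mul_sub, sub_mul, hFF, hFF', h1, h2]; abel
  have hPA : Commute P A := (D.commute i).add_left (D.commute j)
  have hJA : Commute J A := hF.sub_left hF'
  have hrot := joinedIn_unitCentralizer_of_continuous (A := A)
    (f := fun t => 1 - P + Real.cos (t * Real.pi) • P + Real.sin (t * Real.pi) • J) (by fun_prop)
    fun t _ _ => mem_unitCentralizer_of_mul_eq_one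
      (Y := 1 - P + Real.cos (t * Real.pi) • P - Real.sin (t * Real.pi) • J)
      ((((Commute.one_left A).sub_left hPA).add_left (hPA.smul_left _)).add_left
        (hJA.smul_left _)) (by
        have hcs := Real.sin_sq_add_cos_sq (t * Real.pi)
        generalize Real.sin (t * Real.pi) = s at hcs ⊢
        generalize Real.cos (t * Real.pi) = c at hcs ⊢
        simp only [mul_add, add_mul, mul_sub, sub_mul, mul_one, one_mul, Matrix.mul_smul,
          Matrix.smul_mul, hPP, hPJ, hJP, hJJ]
        have hcs' : (s ^ 2 + c ^ 2) • P = P := by rw [hcs, one_smul]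
        rw [← sub_eq_zero, ← sub_eq_zero.2 hcs']
        module)
  have hrot' : JoinedIn (unitCentralizer A) 1 (D.reflection {i, j}) := by
    convert hrot using 1
    · simp
    · simp [reflection, Finset.sum_pair hij, two_smul, ← hP]
      abel
  have hmul := hrot'.unitCentralizer_mul (JoinedIn.refl (D.reflection_mem_unitCentralizer {i}))
  have hprod : D.reflection {i, j} * D.reflection {i} = D.reflection {j} := by
    have : ({i, j} : Finset D.ι) = {j} ∪ {i} := by ext; simp [or_comm]
    rw [this, ← D.reflection_mul_reflection (by simpa using hij.symm), mul_assoc,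
      D.reflection_mul_self, mul_one]
  rwa [one_mul, hprod] at hmul

open Classical in
theorem exists_joinedIn_reflection_image {ρ : D.ι → D.ι}
    (hρ : ∀ i, D.IsReal i →
      Ideal.span {D.p i ^ D.e i} = Ideal.span {D.p (ρ i) ^ D.e (ρ i)}) (s : Finset D.ι) :
    ∃ t ⊆ (s.filter D.IsReal).image ρ,
      JoinedIn (unitCentralizer A) (D.reflection s) (D.reflection t) := by
  induction s using Finset.induction_on with
  | empty => exact ⟨∅, by simp, JoinedIn.refl (D.reflection_mem_unitCentralizer _)⟩
  | insert i s hi ih =>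
    obtain ⟨t, hts, ht⟩ := ih
    have hins : D.reflection (insert i s) = D.reflection {i} * D.reflection s := by
      rw [D.reflection_mul_reflection (Finset.disjoint_singleton_left.2 hi)]
      rfl
    have hsub : (s.filter D.IsReal).image ρ ⊆ ((insert i s).filter D.IsReal).image ρ :=
      Finset.image_subset_image (Finset.filter_subset_filter _ (Finset.subset_insert i s))
    rw [hins]
    by_cases hr : D.IsReal i
    · have h := (D.joinedIn_reflection_singleton i (ρ i) (hρ i hr)).unitCentralizer_mul ht
      by_cases hit : ρ i ∈ t
      · refine ⟨t.erase (ρ i), ((Finset.erase_subset _ _).trans hts).trans hsub, ?_⟩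
        have h' : D.reflection t = D.reflection {ρ i} * D.reflection (t.erase (ρ i)) := by
          rw [D.reflection_mul_reflection (by simp)]
          congr 1
          exact (Finset.insert_erase hit).symm
        rwa [h', ← mul_assoc, D.reflection_mul_self, one_mul] at h
      · refine ⟨insert (ρ i) t, ?_, ?_⟩
        · refine Finset.insert_subset ?_ (hts.trans hsub)
          exact Finset.mem_image_of_mem _ (by simp [hr])
        · rwa [D.reflection_mul_reflection (Finset.disjoint_singleton_left.2 hit)] at h
    · refine ⟨t, hts.trans hsub, ?_⟩
      simpa using (D.joinedIn_reflection_singleton_one hr).unitCentralizer_mul ht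

end CyclicDecomposition

end Reflections

section BlockTypes

open Polynomial Module

theorem LinearMap.finrank_range_pow_succ_add {V : Type*} [AddCommGroup V] [Module ℝ V]
    [FiniteDimensional ℝ V] (f : Module.End ℝ V) (k : ℕ) :
    finrank ℝ (LinearMap.range (f ^ (k + 1))) +
      finrank ℝ ↥(LinearMap.ker f ⊓ LinearMap.range (f ^ k)) =
        finrank ℝ (LinearMap.range (f ^ k)) := by
  have h := LinearMap.finrank_range_add_finrank_ker (f.domRestrict (LinearMap.range (f ^ k)))
  rw [← h]
  congr 1
  · rw [LinearMap.range_domRestrict, pow_succ', Module.End.mul_eq_comp, LinearMap.range_comp]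
  · rw [inf_comm, ← Submodule.map_comap_subtype, Submodule.finrank_map_subtype_eq]
    rfl

theorem LinearMap.two_mul_finrank_range_pow_lt {V : Type*} [AddCommGroup V] [Module ℝ V]
    [FiniteDimensional ℝ V] (f : Module.End ℝ V) (k : ℕ) {v : V} (hv : f v = 0)
    (hvk : v ∈ LinearMap.range (f ^ k)) (hvk' : v ∉ LinearMap.range (f ^ (k + 1))) :
    2 * finrank ℝ (LinearMap.range (f ^ (k + 1))) <
      finrank ℝ (LinearMap.range (f ^ k)) + finrank ℝ (LinearMap.range (f ^ (k + 2))) := by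
  have h1 := f.finrank_range_pow_succ_add k
  have h2 : finrank ℝ (LinearMap.range (f ^ (k + 2))) + _ = _ :=
    f.finrank_range_pow_succ_add (k + 1)
  have h3 : LinearMap.ker f ⊓ LinearMap.range (f ^ (k + 1)) <
      LinearMap.ker f ⊓ LinearMap.range (f ^ k) := by
    refine lt_of_le_of_ne (inf_le_inf_left _ ?_) fun h => ?_
    · rw [pow_succ, Module.End.mul_eq_comp]
      exact LinearMap.range_comp_le_range _ _
    · have : v ∈ LinearMap.ker f ⊓ LinearMap.range (f ^ k) := ⟨hv, hvk⟩
      rw [← h] at this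
      exact hvk' this.2
  have h4 := Submodule.finrank_lt_finrank_of_lt h3
  omega

variable {n : ℕ}

/-- The pairs counted by `gammaOf`. -/
def gammaSet (A : Matrix (Fin n) (Fin n) ℝ) : Set (ℝ × ℕ) :=
  {p | 1 ≤ p.2 ∧ p.2 ≤ n ∧ 2 * ((A - p.1 • 1) ^ p.2).rank <
    ((A - p.1 • 1) ^ (p.2 - 1)).rank + ((A - p.1 • 1) ^ (p.2 + 1)).rank}

theorem finite_gammaSet (A : Matrix (Fin n) (Fin n) ℝ) : (gammaSet A).Finite := by
  refine ((A.charpoly.roots.toFinset.finite_toSet).prod (Finset.Icc 1 n).finite_toSet).subset ?_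
  rintro ⟨r, j⟩ ⟨h1, h2, h3⟩
  refine ⟨?_, by simpa using ⟨h1, h2⟩⟩
  by_contra hr
  have hu : IsUnit (A - r • 1) := by
    rw [Matrix.isUnit_iff_isUnit_det, isUnit_iff_ne_zero]
    intro h0
    apply hr
    simp only [Finset.mem_coe, Multiset.mem_toFinset, mem_roots A.charpoly_monic.ne_zero, IsRoot]
    rw [Matrix.eval_charpoly, ← neg_sub, Matrix.det_neg, Matrix.scalar_apply,
      ← Matrix.smul_one_eq_diagonal, h0, mul_zero]
  have h (k : ℕ) : ((A - r • 1) ^ k).rank = n := by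
    rw [Matrix.rank_of_isUnit _ (hu.pow k), Fintype.card_fin]
  simp only [h] at h3
  omega

namespace CyclicDecomposition

variable {A : Matrix (Fin n) (Fin n) ℝ} (D : CyclicDecomposition A)

theorem span_eq_of_isRoot {i : D.ι} {r : ℝ} (hr : (D.p i).IsRoot r) :
    Ideal.span {D.p i ^ D.e i} = Ideal.span {(X - C r) ^ D.e i} := by
  rw [Ideal.span_singleton_eq_span_singleton]
  exact (((irreducible_X_sub_C r).associated_of_dvd (D.irreducible i) (dvd_iff_isRoot.2 hr)).symm).pow_pow

theorem aeval_mul_eq_zero_iff_of_isRoot {i : D.ι} {r : ℝ} (hr : (D.p i).IsRoot r) (g : ℝ[X]) :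
    aeval A g * D.E i = 0 ↔ (X - C r) ^ D.e i ∣ g := by
  rw [D.aeval_mul_eq_zero_iff, ← Ideal.span_singleton_le_span_singleton,
    D.span_eq_of_isRoot hr, Ideal.span_singleton_le_span_singleton]

theorem commute_sub_smul_pow (i : D.ι) (r : ℝ) (m : ℕ) : Commute ((A - r • 1) ^ m) (D.E i) :=
  ((D.commute i).symm.sub_left ((Commute.one_left _).smul_left r)).pow_left m

theorem exists_sub_smul_pow_mulVec_ne_zero {i : D.ι} {r : ℝ} (hi : D.e i ≠ 0)
    (hr : (D.p i).IsRoot r) : ∃ k w, D.e i = k + 1 ∧ (A - r • 1) ^ (k + 1) * D.E i = 0 ∧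
      ((A - r • 1) ^ k * D.E i) *ᵥ w ≠ 0 := by
  have hN (k : ℕ) : aeval A ((X - C r) ^ k) = (A - r • 1) ^ k := by
    simp [Algebra.algebraMap_eq_smul_one]
  obtain ⟨k, hk⟩ : ∃ k, D.e i = k + 1 := Nat.exists_eq_succ_of_ne_zero hi
  have hne : (A - r • 1) ^ k * D.E i ≠ 0 := by
    rw [← hN, Ne, D.aeval_mul_eq_zero_iff_of_isRoot hr, hk]
    intro h
    have := natDegree_le_of_dvd h (pow_ne_zero _ (X_sub_C_ne_zero r))
    simp at this
  obtain ⟨w, hw⟩ : ∃ w, ((A - r • 1) ^ k * D.E i) *ᵥ w ≠ 0 := by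
    by_contra! h
    exact hne (Matrix.ext_of_mulVec_single fun j => by rw [h, zero_mulVec])
  exact ⟨k, w, hk, by rw [← hN, D.aeval_mul_eq_zero_iff_of_isRoot hr, hk], hw⟩

theorem mem_gammaSet {i : D.ι} {r : ℝ} (hi : D.e i ≠ 0) (hr : (D.p i).IsRoot r) :
    (r, D.e i) ∈ gammaSet A := by
  obtain ⟨k, w, hk, h0, hw⟩ := D.exists_sub_smul_pow_mulVec_ne_zero hi hr
  have hle : D.e i ≤ n := by
    have h : (X - C r) ^ D.e i ∣ A.charpoly :=
      (D.aeval_mul_eq_zero_iff_of_isRoot hr _).1 (by rw [A.aeval_self_charpoly, zero_mul])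
    simpa using natDegree_le_of_dvd h A.charpoly_monic.ne_zero
  have key := LinearMap.two_mul_finrank_range_pow_lt (toLin' (A - r • 1)) k
    (v := ((A - r • 1) ^ k * D.E i) *ᵥ w) (by
      rw [toLin'_apply, mulVec_mulVec, ← mul_assoc, ← pow_succ', h0, zero_mulVec]) (by
      rw [← toLin'_pow]
      exact ⟨D.E i *ᵥ w, by rw [toLin'_apply, mulVec_mulVec]⟩) (by
      rw [← toLin'_pow]
      rintro ⟨u, hu⟩
      rw [toLin'_apply] at hu
      apply hw
      rw [← D.mul_self i, ← mul_assoc, (D.commute_sub_smul_pow i r k).eq, mul_assoc, ← mulVec_mulVec, ← hu,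
        mulVec_mulVec, ← (D.commute_sub_smul_pow i r (k + 1)).eq, h0, zero_mulVec])
  refine ⟨Nat.one_le_iff_ne_zero.2 hi, hle, ?_⟩
  have hrank (m : ℕ) : ((A - r • 1) ^ m).rank =
      finrank ℝ (LinearMap.range (toLin' (A - r • 1) ^ m)) := by
    rw [← toLin'_pow]
    rfl
  dsimp only
  rw [hk, hrank, hrank, hrank]
  exact key

end CyclicDecomposition

end BlockTypes

section Perron

variable {n : ℕ} {A : Matrix (Fin n) (Fin n) ℝ}

theorem PosEntries.mulVec_pos (hA : PosEntries A) {x : Fin n → ℝ} (hx : 0 ≤ x) (hx0 : x ≠ 0)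
    (i : Fin n) : 0 < (A *ᵥ x) i := by
  obtain ⟨j, hj⟩ := Function.ne_iff.1 hx0
  exact Finset.sum_pos' (fun k _ => mul_nonneg (hA i k).le (hx k))
    ⟨j, Finset.mem_univ j, mul_pos (hA i j) ((hx j).lt_of_ne' hj)⟩

theorem PosEntries.exists_pos_eigenvector [NeZero n] (hA : PosEntries A) :
    ∃ (r : ℝ) (x : Fin n → ℝ), (∀ i, 0 < x i) ∧ A *ᵥ x = r • x := by
  let M := ∑ i, ∑ j, A i j
  let K : Set ((Fin n → ℝ) × ℝ) := (stdSimplex ℝ (Fin n) ×ˢ Set.Icc 0 M) ∩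
    {q | ∀ i, q.2 * q.1 i ≤ (A *ᵥ q.1) i}
  have hM {x : Fin n → ℝ} {r : ℝ} (hx : x ∈ stdSimplex ℝ (Fin n))
      (hr : ∀ i, r * x i ≤ (A *ᵥ x) i) : r ≤ M := by
    have h1 : ∑ i, r * x i ≤ ∑ i, (A *ᵥ x) i := Finset.sum_le_sum fun i _ => hr i
    rw [← Finset.mul_sum, hx.2, mul_one] at h1
    refine h1.trans (Finset.sum_le_sum fun i _ =>
      (Finset.sum_le_sum fun j _ => ?_ : ∑ j, A i j * x j ≤ ∑ j, A i j))
    exact mul_le_of_le_one_right (hA i j).le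
      (hx.2 ▸ Finset.single_le_sum (fun k _ => hx.1 k) (Finset.mem_univ j))
  have hK : IsCompact K := by
    refine ((isCompact_stdSimplex ℝ (Fin n)).prod isCompact_Icc).inter_right ?_
    simp only [Set.ofPred_forall]
    refine isClosed_iInter fun i => isClosed_le (by fun_prop) ?_
    exact (continuous_apply i).comp ((Continuous.matrix_mulVec continuous_const continuous_fst))
  have hKne : K.Nonempty := by
    refine ⟨(Pi.single 0 1, 0), ⟨single_mem_stdSimplex ℝ 0, le_rfl, ?_⟩, fun i => ?_⟩
    · exact Finset.sum_nonneg fun i _ => Finset.sum_nonneg fun j _ => (hA i j).le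
    · simpa using (hA i 0).le
  obtain ⟨⟨x, r⟩, ⟨⟨hx, hr0, -⟩, hxr⟩, hmax⟩ := hK.exists_isMaxOn hKne continuous_snd.continuousOn
  dsimp only at hx hr0 hxr hmax
  have hx0 : x ≠ 0 := by
    rintro rfl
    simpa using hx.2
  have hAx := hA.mulVec_pos hx.1 hx0
  have heq : A *ᵥ x = r • x := by
    by_contra hne
    set y := A *ᵥ x with hy
    have hd (i : Fin n) : r * y i < (A *ᵥ y) i := by
      have := hA.mulVec_pos (x := y - r • x) (fun i => by simpa using hxr i)
        (sub_ne_zero.2 hne) i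
      rw [mulVec_sub, mulVec_smul, ← hy] at this
      simpa using this
    obtain ⟨i₀, -, hi₀⟩ := Finset.exists_min_image Finset.univ (fun i => (A *ᵥ y) i / y i)
      ⟨0, Finset.mem_univ 0⟩
    set r' := (A *ᵥ y) i₀ / y i₀
    have hrr' : r < r' := (lt_div_iff₀ (hAx i₀)).2 (hd i₀)
    have hr' (i : Fin n) : r' * y i ≤ (A *ᵥ y) i :=
      (le_div_iff₀ (hAx i)).1 (hi₀ i (Finset.mem_univ i))
    have hs : 0 < ∑ i, y i := Finset.sum_pos (fun i _ => hAx i) ⟨0, Finset.mem_univ 0⟩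
    set z := (∑ i, y i)⁻¹ • y
    have hz : z ∈ stdSimplex ℝ (Fin n) := by
      refine ⟨fun i => mul_nonneg (inv_nonneg.2 hs.le) (hAx i).le, ?_⟩
      simp only [z, Pi.smul_apply, smul_eq_mul, ← Finset.mul_sum]
      exact inv_mul_cancel₀ hs.ne'
    have hzr (i : Fin n) : r' * z i ≤ (A *ᵥ z) i := by
      simp only [z, mulVec_smul, Pi.smul_apply, smul_eq_mul]
      rw [mul_left_comm]
      exact mul_le_mul_of_nonneg_left (hr' i) (inv_nonneg.2 hs.le)
    have : r' ≤ r := hmax (a := (z, r')) ⟨⟨hz, hr0.trans hrr'.le, hM hz hzr⟩, hzr⟩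
    exact absurd hrr' this.not_gt
  refine ⟨r, x, fun i => (hx.1 i).lt_of_ne' fun h => ?_, heq⟩
  have := hAx i
  rw [heq] at this
  simp [h] at this

theorem PosEntries.eq_smul_of_eigenvector [NeZero n] (hA : PosEntries A) {r : ℝ} {x y : Fin n → ℝ}
    (hx : ∀ i, 0 < x i) (hAx : A *ᵥ x = r • x) (hAy : A *ᵥ y = r • y) : ∃ c : ℝ, y = c • x := by
  obtain ⟨i₀, -, hi₀⟩ := Finset.exists_min_image Finset.univ (fun i => y i / x i)
    ⟨0, Finset.mem_univ 0⟩
  refine ⟨y i₀ / x i₀, ?_⟩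
  by_contra hne
  have := hA.mulVec_pos (x := y - (y i₀ / x i₀) • x) (fun i => by
    simpa using (le_div_iff₀ (hx i)).1 (hi₀ i (Finset.mem_univ i))) (sub_ne_zero.2 hne) i₀
  rw [mulVec_sub, mulVec_smul, hAx, hAy, smul_comm, ← smul_sub] at this
  simp [(hx i₀).ne'] at this

open Polynomial

theorem CyclicDecomposition.exists_unique_isRoot [NeZero n] (D : CyclicDecomposition A)
    (hA : PosEntries A) : ∃ (i₀ : D.ι) (r : ℝ), D.e i₀ ≠ 0 ∧ (D.p i₀).IsRoot r ∧
      ∀ i, D.e i ≠ 0 → (D.p i).IsRoot r → i = i₀ := by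
  obtain ⟨r, x, hx, hAx⟩ := hA.exists_pos_eigenvector
  have hx0 : x ≠ 0 := fun h => (hx 0).ne' (congrFun h 0)
  obtain ⟨i₀, hi₀⟩ : ∃ i, D.E i *ᵥ x ≠ 0 := by
    by_contra! h
    apply hx0
    rw [← one_mulVec x, ← D.sum_eq_one, sum_mulVec]
    exact Finset.sum_eq_zero fun i _ => h i
  have hfix : (A - r • 1) *ᵥ x = 0 := by
    rw [sub_mulVec, hAx, smul_mulVec, one_mulVec, sub_self]
  have hN : aeval A (X - C r) = A - r • 1 := by
    simp [Algebra.algebraMap_eq_smul_one]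
  have hdvd : D.p i₀ ∣ X - C r := by
    by_contra h
    obtain ⟨a, b, hab⟩ := D.isCoprime_pow_of_not_dvd i₀ h
    apply hi₀
    have h1 := congrArg (fun g => (aeval A g * D.E i₀) *ᵥ x) hab
    have h2 : aeval A (D.p i₀ ^ D.e i₀) * D.E i₀ = 0 := (D.aeval_mul_eq_zero_iff i₀ _).2 dvd_rfl
    have h3 : (aeval A a * (A - r • 1) * D.E i₀) *ᵥ x = 0 := by
      have := (D.commute_sub_smul_pow i₀ r 1).eq
      rw [pow_one] at this
      rw [mul_assoc, this, ← mul_assoc, ← mulVec_mulVec, hfix, mulVec_zero]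
    rw [map_add, map_mul, map_mul, add_mul, mul_assoc (aeval A b), h2, hN, add_mulVec, h3] at h1
    simpa using h1.symm
  have hroot : (D.p i₀).IsRoot r := by
    rw [← dvd_iff_isRoot]
    exact ((D.irreducible i₀).associated_of_dvd (irreducible_X_sub_C r) hdvd).symm.dvd
  refine ⟨i₀, r, fun h => hi₀ ?_, hroot, fun i hi hri => ?_⟩
  · rw [D.E_eq_zero i₀ h, zero_mulVec]
  · obtain ⟨k, w, -, h0, hw⟩ := D.exists_sub_smul_pow_mulVec_ne_zero hi hri
    obtain ⟨c, hc⟩ := hA.eq_smul_of_eigenvector (y := ((A - r • 1) ^ k * D.E i) *ᵥ w) hx hAx (by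
      rw [← sub_eq_zero, ← one_mulVec (r • _), mulVec_smul, ← smul_mulVec, ← sub_mulVec,
        mulVec_mulVec, ← mul_assoc, ← pow_succ', h0, zero_mulVec])
    by_contra hne
    have h1 : D.E i₀ *ᵥ (c • x) = 0 := by
      rw [← hc, (D.commute_sub_smul_pow i r k).eq, mulVec_mulVec, ← mul_assoc,
        D.mul_of_ne i₀ i (Ne.symm hne), zero_mul, zero_mulVec]
    rw [mulVec_smul] at h1
    rcases smul_eq_zero.1 h1 with rfl | h1
    · exact hw (by rw [hc, zero_smul])
    · exact hi₀ h1

end Perron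

section PathConnected

open Polynomial

variable {n : ℕ} {A : Matrix (Fin n) (Fin n) ℝ}

open Classical in
theorem CyclicDecomposition.exists_finset_reflection [NeZero n] (D : CyclicDecomposition A)
    (hA : PosEntries A) : ∃ T : Finset (Finset D.ι), T.card ≤ 2 ^ (gammaOf A - 1) ∧
      ∀ X ∈ unitCentralizer A, ∃ t ∈ T, JoinedIn (unitCentralizer A) X (D.reflection t) ∨
        JoinedIn (unitCentralizer A) (-X) (D.reflection t) := by
  obtain ⟨i₀, r₀, hi₀, hr₀, huniq⟩ := D.exists_unique_isRoot hA
  have : Nonempty D.ι := ⟨i₀⟩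
  have hroot : ∀ i, ∃ r, D.IsReal i → (D.p i).IsRoot r := by
    intro i
    by_cases h : D.IsReal i
    · exact h.2.imp fun r hr _ => hr
    · exact ⟨0, fun h' => absurd h' h⟩
  choose r hr using hroot
  let f : D.ι → ℝ × ℕ := fun i => (r i, D.e i)
  have hspan {i j : D.ι} (hi : D.IsReal i) (hj : D.IsReal j) (hij : f i = f j) :
      Ideal.span {D.p i ^ D.e i} = Ideal.span {D.p j ^ D.e j} := by
    obtain ⟨h1, h2⟩ := Prod.ext_iff.1 hij
    dsimp only [f] at h1 h2
    rw [D.span_eq_of_isRoot (hr i hi), D.span_eq_of_isRoot (hr j hj), h1, h2]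
  let ρ : D.ι → D.ι := fun i => Function.invFunOn f {j | D.IsReal j} (f i)
  have hρ (i : D.ι) (hi : D.IsReal i) :
      Ideal.span {D.p i ^ D.e i} = Ideal.span {D.p (ρ i) ^ D.e (ρ i)} :=
    hspan hi (Function.invFunOn_mem (s := {j | D.IsReal j}) ⟨i, hi, rfl⟩)
      (Function.invFunOn_eq (s := {j | D.IsReal j}) ⟨i, hi, rfl⟩).symm
  have hreal : D.IsReal i₀ := ⟨hi₀, r₀, hr₀⟩
  let S := ((Finset.univ.erase i₀).filter D.IsReal).image f
  have hS : S ⊆ (finite_gammaSet A).toFinset.erase (f i₀) := by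
    intro q hq
    obtain ⟨i, hi, rfl⟩ := Finset.mem_image.1 hq
    rw [Finset.mem_filter, Finset.mem_erase] at hi
    rw [Finset.mem_erase, Set.Finite.mem_toFinset]
    refine ⟨fun h => hi.1.1 (huniq i hi.2.1 ?_), D.mem_gammaSet hi.2.1 (hr i hi.2)⟩
    have hdvd := Ideal.span_singleton_le_span_singleton.1 (hspan hi.2 hreal h).le
    have : (D.p i ^ D.e i).IsRoot r₀ :=
      IsRoot.dvd (by rw [IsRoot, eval_pow, hr₀.eq_zero, zero_pow hi₀]) hdvd
    rw [IsRoot, eval_pow] at this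
    exact pow_eq_zero_iff hi.2.1 |>.1 this
  have hScard : S.card ≤ gammaOf A - 1 := by
    refine (Finset.card_le_card hS).trans ?_
    rw [Finset.card_erase_of_mem (by simpa using D.mem_gammaSet hi₀ (hr i₀ hreal)),
      ← Set.ncard_eq_toFinset_card _ (finite_gammaSet A)]
    rfl
  refine ⟨(S.image (Function.invFunOn f {j | D.IsReal j})).powerset, ?_, fun X hX => ?_⟩
  · rw [Finset.card_powerset]
    exact Nat.pow_le_pow_right two_pos (Finset.card_image_le.trans hScard)
  · obtain ⟨s, hs, hXs⟩ := D.exists_joinedIn_reflection i₀ hX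
    obtain ⟨t, ht, hst⟩ := D.exists_joinedIn_reflection_image hρ s
    refine ⟨t, Finset.mem_powerset.2 (ht.trans ?_), hXs.imp (·.trans hst) (·.trans hst)⟩
    intro j hj
    obtain ⟨i, hi, rfl⟩ := Finset.mem_image.1 hj
    rw [Finset.mem_filter] at hi
    exact Finset.mem_image_of_mem _ (Finset.mem_image_of_mem _ (Finset.mem_filter.2
      ⟨Finset.mem_erase.2 ⟨fun h => hs (h ▸ hi.1), Finset.mem_univ i⟩, hi.2⟩))

theorem ConjOver.exists_mem_unitsOver {U : Subring ℝ} {B : Matrix (Fin n) (Fin n) ℝ}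
    (h : ConjOver (U : Set ℝ) A B) : ∃ W ∈ unitsOver U n, W⁻¹ * A * W = B := by
  obtain ⟨W, V, hW, hV, h1, -, hB⟩ := h
  exact ⟨W, mem_unitsOver_of_mul_eq_one hW hV h1, by rw [Matrix.inv_eq_right_inv h1, hB]⟩

open Classical in
theorem exists_finset_sse_of_isPreconnected [NeZero n] {U : Subring ℝ} (hU : Dense (U : Set ℝ))
    (hAU : entriesIn (U : Set ℝ) A) (hA : PosEntries A) {C : Set (Matrix (Fin n) (Fin n) ℝ)}
    (hC : IsPreconnected C) (hAC : A ∈ C)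
    (hCA : ∀ M ∈ C, PosEntries M ∧ ∃ G, IsUnit G.det ∧ G⁻¹ * A * G = M) :
    ∃ F : Finset (Matrix (Fin n) (Fin n) ℝ), F.card ≤ 2 ^ (gammaOf A - 1) ∧
      ∀ B ∈ C, ConjOver (U : Set ℝ) A B →
        ∃ M ∈ F, SSE {x : ℝ | x ∈ U ∧ 0 ≤ x} ⟨n, B⟩ ⟨n, M⟩ := by
  obtain ⟨D⟩ := nonempty_cyclicDecomposition A
  obtain ⟨T, hT, hTX⟩ := D.exists_finset_reflection hA
  have hsub : unitCentralizer A ⊆ conjDomain A := fun z hz => by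
    simpa using mul_mem_conjDomain hz (one_mem_conjDomain hA)
  have hrefl (t : Finset D.ι) : D.reflection t ∈ conjDomain A :=
    hsub (D.reflection_mem_unitCentralizer t)
  choose R hR using fun t => exists_representsAt hU hAU (hrefl t)
  refine ⟨T.image R, Finset.card_image_le.trans hT, fun B hB hAB => ?_⟩
  obtain ⟨W, hW, rfl⟩ := hAB.exists_mem_unitsOver
  have hWC : W ∈ conjDomain A := ⟨hW.2.2, (hCA _ hB).1⟩
  obtain ⟨G, hG, γ, hγ⟩ := exists_joinedIn_conjDomain hC hAC hCA _ hB
  have hGdet : IsUnit G.det := by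
    have := (hγ 1).1
    rwa [γ.target] at this
  have hz := mul_inv_mem_unitCentralizer hW.2.2 hGdet hG.symm
  have hWz : JoinedIn (conjDomain A) W (W * G⁻¹) := by
    have : JoinedIn (conjDomain A) (W * G⁻¹ * 1) (W * G⁻¹ * G) :=
      ⟨γ.map (continuous_const_mul (W * G⁻¹)), fun t => mul_mem_conjDomain hz (hγ t)⟩
    rw [mul_one, mul_assoc, Matrix.nonsing_inv_mul _ hGdet, mul_one] at this
    exact this.symm
  have hrep := (representsAt_self hU hAU hWC hW).of_joinedIn hU hAU hWz
  obtain ⟨t, ht, htz⟩ := hTX _ hz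
  refine ⟨R t, Finset.mem_image_of_mem R ht, RepresentsAt.sse hU (hrefl t).1 ?_ (hR t)⟩
  rcases htz with h | h
  · exact hrep.of_joinedIn hU hAU (h.mono hsub)
  · exact hrep.neg.of_joinedIn hU hAU (h.mono hsub)

end PathConnected

section Finiteness

open MvPolynomial Topology Filter

variable {n : ℕ} {A : Matrix (Fin n) (Fin n) ℝ}

/-- The matrix with the given coordinates. -/
def coordMatrix (x : Fin n × Fin n → ℝ) : Matrix (Fin n) (Fin n) ℝ :=
  Matrix.of fun i j => x (i, j)

theorem continuous_coordMatrix : Continuous (coordMatrix (n := n)) :=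
  continuous_matrix fun i j => continuous_apply (i, j)

/-- The product of the adjugate of a generic matrix, the matrix `A` and the generic matrix. -/
noncomputable def adjugateConj (A : Matrix (Fin n) (Fin n) ℝ) :
    Matrix (Fin n) (Fin n) (MvPolynomial (Fin n × Fin n) ℝ) :=
  (mvPolynomialX (Fin n) (Fin n) ℝ).adjugate * (C : ℝ →+* _).mapMatrix A *
    mvPolynomialX (Fin n) (Fin n) ℝ

/-- A polynomial in the entries of a matrix which vanishes on the boundary, inside the
invertible matrices, of the set of `G` in `conjDomain A` with Frobenius norm less than `1`. -/
noncomputable def boundaryPolynomial (A : Matrix (Fin n) (Fin n) ℝ) :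
    MvPolynomial (Fin n × Fin n) ℝ :=
  (1 - ∑ p, X p ^ 2) * (mvPolynomialX (Fin n) (Fin n) ℝ).det *
    ∏ i, ∏ j, adjugateConj A i j

theorem eval_boundaryPolynomial_ne_zero_iff (x : Fin n × Fin n → ℝ) :
    eval x (boundaryPolynomial A) ≠ 0 ↔ ∑ p, x p ^ 2 ≠ 1 ∧ IsUnit (coordMatrix x).det ∧
      ∀ i j, ((coordMatrix x)⁻¹ * A * coordMatrix x) i j ≠ 0 := by
  have hX : (eval x).mapMatrix (mvPolynomialX (Fin n) (Fin n) ℝ) = coordMatrix x := by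
    ext i j
    simp [coordMatrix, mvPolynomialX]
  have hA : (eval x).mapMatrix ((C : ℝ →+* _).mapMatrix A) = A := by
    ext i j
    simp
  have hdet : eval x (mvPolynomialX (Fin n) (Fin n) ℝ).det = (coordMatrix x).det := by
    rw [RingHom.map_det, hX]
  have hent (i j : Fin n) : eval x (adjugateConj A i j) =
      ((coordMatrix x).adjugate * A * coordMatrix x) i j := by
    change (eval x).mapMatrix (adjugateConj A) i j = _
    rw [adjugateConj, map_mul, map_mul, RingHom.map_adjugate, hX, hA]
  simp only [boundaryPolynomial, map_mul, map_prod, hdet, hent, mul_ne_zero_iff, map_sub, map_one,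
    map_sum, map_pow, eval_X, sub_ne_zero, Finset.prod_ne_zero_iff, Finset.mem_univ, true_imp_iff,
    and_assoc, isUnit_iff_ne_zero, ne_comm (a := (1 : ℝ))]
  refine and_congr_right fun _ => and_congr_right fun hd => ?_
  simp [Matrix.inv_def, hd]

theorem exists_finset_sse {U : Subring ℝ} (hU : Dense (U : Set ℝ))
    (hAU : entriesIn (U : Set ℝ) A) : ∃ F : Finset (Matrix (Fin n) (Fin n) ℝ),
      ∀ B, PosEntries B → ConjOver (U : Set ℝ) A B →
        ∃ M ∈ F, SSE {x : ℝ | x ∈ U ∧ 0 ≤ x} ⟨n, B⟩ ⟨n, M⟩ := by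
  classical
  obtain ⟨Z, hZ, hZV⟩ := (boundaryPolynomial A).exists_finite_inter_nonempty
  have hrep (x : Fin n × Fin n → ℝ) :
      ∃ B, coordMatrix x ∈ conjDomain A → RepresentsAt U A (coordMatrix x) B := by
    by_cases h : coordMatrix x ∈ conjDomain A
    · obtain ⟨B, hB⟩ := exists_representsAt hU hAU h
      exact ⟨B, fun _ => hB⟩
    · exact ⟨0, fun h' => absurd h' h⟩
  choose R hR using hrep
  refine ⟨hZ.toFinset.image R, fun B hB hAB => ?_⟩
  obtain ⟨W, hW, rfl⟩ := hAB.exists_mem_unitsOver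
  let V : Set (Fin n × Fin n → ℝ) := {x | coordMatrix x ∈ conjDomain A ∧ ∑ p, x p ^ 2 < 1 ∧
    RepresentsAt U A (coordMatrix x) (W⁻¹ * A * W)}
  have hsq : Continuous fun x : Fin n × Fin n → ℝ => ∑ p, x p ^ 2 := by fun_prop
  suffices h : (V ∩ Z).Nonempty by
    obtain ⟨z, ⟨hzA, -, hz⟩, hzZ⟩ := h
    exact ⟨R z, Finset.mem_image_of_mem R (hZ.mem_toFinset.2 hzZ), hz.sse hU hzA.1 (hR z hzA)⟩
  refine hZV V ?_ ?_ ?_ ?_ ?_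
  · let w : Fin n × Fin n → ℝ := fun p => W p.1 p.2
    obtain ⟨c, hc, hc0⟩ : ∃ c : ℝ, ∑ p, (c • w) p ^ 2 < 1 ∧ 0 < c := by
      have h : Tendsto (fun c : ℝ => ∑ p, (c • w) p ^ 2) (𝓝[>] 0) (𝓝 0) := by
        refine ((hsq.comp (continuous_id.smul continuous_const)).tendsto' 0 0 ?_).mono_left
          nhdsWithin_le_nhds
        simp
      exact ((h.eventually_lt_const one_pos).and self_mem_nhdsWithin).exists
    have hcw : coordMatrix (c • w) = c • W := rfl
    refine ⟨c • w, ?_, hc, ?_⟩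
    · rw [hcw]
      exact smul_mem_conjDomain ⟨hW.2.2, hB⟩ hc0.ne'
    · rw [hcw]
      exact (representsAt_self hU hAU ⟨hW.2.2, hB⟩ hW).smul hc0
  · rw [isOpen_iff_mem_nhds]
    rintro x ⟨h1, h2, h3⟩
    have hx := continuous_coordMatrix.tendsto x
    exact (hx.eventually ((isOpen_conjDomain A).eventually_mem h1)).and
      ((hsq.continuousAt.eventually_lt_const h2).and (hx.eventually h3.eventually))
  · refine (Metric.isBounded_closedBall (x := (0 : Fin n × Fin n → ℝ)) (r := 1)).subset ?_
    rintro x ⟨-, h, -⟩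
    rw [mem_closedBall_zero_iff, pi_norm_le_iff_of_nonneg zero_le_one]
    intro p
    have := Finset.single_le_sum (f := fun p => x p ^ 2) (fun p _ => sq_nonneg _)
      (Finset.mem_univ p)
    rw [Real.norm_eq_abs, ← sq_le_one_iff_abs_le_one]
    exact this.trans h.le
  · rintro x ⟨h1, h2, -⟩
    exact (eval_boundaryPolynomial_ne_zero_iff x).2 ⟨h2.ne, h1.1, fun i j => (h1.2 i j).ne'⟩
  · intro x hx hQ
    obtain ⟨h1, h2, h3⟩ := (eval_boundaryPolynomial_ne_zero_iff x).1 hQ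
    have hfreq := mem_closure_iff_frequently.1 hx
    have hle : ∑ p, x p ^ 2 ≤ 1 :=
      le_of_tendsto_of_frequently (hsq.tendsto x) (hfreq.mono fun y hy => hy.2.1.le)
    have hc : ContinuousAt (fun y => (coordMatrix y)⁻¹ * A * coordMatrix y) x := by
      have hcx := continuous_coordMatrix.continuousAt (x := x)
      exact (((Matrix.continuousAt_inv_of_isUnit_det h2).comp hcx).mul continuousAt_const).mul hcx
    have hxA : coordMatrix x ∈ conjDomain A := by
      refine ⟨h2, fun i j => lt_of_le_of_ne ?_ (h3 i j).symm⟩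
      have hcij := (continuous_id.matrix_elem i j).continuousAt.comp hc
      exact ge_of_tendsto_of_frequently hcij.tendsto (hfreq.mono fun y hy => (hy.1.2 i j).le)
    exact ⟨hxA, lt_of_le_of_ne hle h1, representsAt_of_frequently hU hAU hxA
      ((continuous_coordMatrix.tendsto x).frequently (hfreq.mono fun y hy => hy.2.2))⟩

end Finiteness

/-- For a dense subring `U` of `ℝ` and a positive matrix `A` over `U`:
(1) on any path-connected set `C` of positive matrices conjugate over `ℝ` to `A` and
containing `A`, the matrices of `C` conjugate over `U` to `A` fall into at most
`2 ^ (γ(A) - 1)` SSE-`U₊` classes; (2) the positive matrices conjugate over `U` to `A`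
intersect only finitely many SSE-`U₊` classes. -/
theorem finite_sse_over_U (U : Subring ℝ) (hU : Dense (U : Set ℝ))
    {n : ℕ} (A : Matrix (Fin n) (Fin n) ℝ)
    (hAU : entriesIn (U : Set ℝ) A) (hApos : PosEntries A) :
    (∀ C : Set (Matrix (Fin n) (Fin n) ℝ),
      IsPathConnected C → A ∈ C →
      (∀ M ∈ C, PosEntries M ∧ ∃ G Ginv : Matrix (Fin n) (Fin n) ℝ,
        G * Ginv = 1 ∧ Ginv * G = 1 ∧ M = Ginv * A * G) →
      ∃ F : Finset (Matrix (Fin n) (Fin n) ℝ),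
        F.card ≤ 2 ^ (gammaOf A - 1) ∧
        ∀ B ∈ C, ConjOver (U : Set ℝ) A B →
          ∃ M ∈ F, SSE {x : ℝ | x ∈ U ∧ 0 ≤ x} ⟨n, B⟩ ⟨n, M⟩) ∧
    (∃ F : Finset (Matrix (Fin n) (Fin n) ℝ),
      ∀ B : Matrix (Fin n) (Fin n) ℝ, PosEntries B → ConjOver (U : Set ℝ) A B →
        ∃ M ∈ F, SSE {x : ℝ | x ∈ U ∧ 0 ≤ x} ⟨n, B⟩ ⟨n, M⟩) := by
  refine ⟨fun C hC hAC hCA => ?_, exists_finset_sse hU hAU⟩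
  rcases Nat.eq_zero_or_pos n with rfl | hn
  · refine ⟨{A}, ?_, fun B _ _ => ⟨A, Finset.mem_singleton_self A, ?_⟩⟩
    · rw [Finset.card_singleton]
      exact Nat.one_le_two_pow
    · rw [Subsingleton.elim B A]
      exact Relation.ReflTransGen.refl
  · have : NeZero n := ⟨hn.ne'⟩
    refine exists_finset_sse_of_isPreconnected hU hAU hApos hC.isConnected.isPreconnected hAC
      fun M hM => ⟨(hCA M hM).1, ?_⟩
    obtain ⟨G, V, h1, -, rfl⟩ := (hCA M hM).2
    exact ⟨G, Matrix.isUnit_det_of_right_inverse h1, by rw [Matrix.inv_eq_right_inv h1]⟩
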